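/- Fix a real number u. As x → ∞, (1/x)·#{n : 1 < n ≤ x and ω(A(n)) − log log x ≤ u·√(log log x)} tends to (1/√(2π)) ∫_{−∞}^{u} e^{−t²/2} dt. -/

import Mathlib

open Filter

/-- The primes `p` with `a < p ≤ b`. -/
noncomputable def primesBetween (a b : ℝ) : Finset ℕ :=
  (Finset.Ioc ⌊a⌋₊ ⌊b⌋₊).filter Nat.Prime

lemma mem_primesBetween {a b : ℝ} (ha : 0 ≤ a) {p : ℕ} :
    p ∈ primesBetween a b ↔ p.Prime ∧ a < p ∧ (p : ℝ) ≤ b := by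
  unfold primesBetween
  rw [Finset.mem_filter, Finset.mem_Ioc, Nat.floor_lt ha]
  constructor
  · rintro ⟨⟨h1, h2⟩, h3⟩
    exact ⟨h3, h1, (Nat.le_floor_iff' h3.ne_zero).1 h2⟩
  · rintro ⟨h1, h2, h3⟩
    exact ⟨⟨h2, Nat.le_floor h3⟩, h1⟩

lemma sum_log_div_primesLE_le (N : ℕ) (hN : 1 ≤ N) :
    ∑ p ∈ N.primesLE, Real.log p / p ≤ Real.log N + Real.log 4 := by
  have hN0 : (0 : ℝ) < N := by exact_mod_cast hN
  have h1 : ∑ p ∈ N.primesLE, ((N / p : ℕ) : ℝ) * Real.log p ≤ N * Real.log N := by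
    calc ∑ p ∈ N.primesLE, ((N / p : ℕ) : ℝ) * Real.log p
        = ∑ p ∈ N.primesLE, ∑ n ∈ Finset.Ioc 0 N, if p ∣ n then Real.log p else 0 := by
          refine Finset.sum_congr rfl fun p _ => ?_
          rw [← Finset.sum_filter, Finset.sum_const, Nat.Ioc_filter_dvd_card_eq_div, nsmul_eq_mul]
      _ = ∑ n ∈ Finset.Ioc 0 N, ∑ p ∈ N.primesLE, if p ∣ n then Real.log p else 0 :=
          Finset.sum_comm
      _ ≤ ∑ n ∈ Finset.Ioc 0 N, Real.log N := by
          refine Finset.sum_le_sum fun n hn => ?_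
          rw [Finset.mem_Ioc] at hn
          rw [← Finset.sum_filter]
          have : (N.primesLE.filter (· ∣ n)) = n.primeFactors := by
            ext p
            simp only [Finset.mem_filter, Nat.mem_primesLE, Nat.mem_primeFactors]
            constructor
            · rintro ⟨⟨_, h⟩, h2⟩; exact ⟨h, h2, by omega⟩
            · rintro ⟨h, h2, _⟩; exact ⟨⟨(Nat.le_of_dvd hn.1 h2).trans hn.2, h⟩, h2⟩
          rw [this, ← Real.log_prod (fun p hp => by
            exact_mod_cast (Nat.prime_of_mem_primeFactors hp).ne_zero)]
          apply Real.log_le_log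
          · exact Finset.prod_pos fun p hp => by
              exact_mod_cast (Nat.prime_of_mem_primeFactors hp).pos
          · have := Nat.le_of_dvd hn.1 (Nat.prod_primeFactors_dvd n)
            rw [← Nat.cast_prod]
            exact Nat.cast_le.2 (this.trans hn.2)
      _ = N * Real.log N := by simp
  have h2 : ∑ p ∈ N.primesLE, ((N : ℝ) / p - 1) * Real.log p ≤ N * Real.log N := by
    refine le_trans (Finset.sum_le_sum fun p hp => ?_) h1
    refine mul_le_mul_of_nonneg_right ?_ (Real.log_natCast_nonneg p)
    have := Nat.lt_floor_add_one ((N : ℝ) / p)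
    rw [Nat.floor_div_natCast, Nat.floor_natCast] at this
    linarith
  have h3 : ∑ p ∈ N.primesLE, Real.log p ≤ Real.log 4 * N := by
    rw [← Chebyshev.theta_eq_sum_primesLE_log]
    exact Chebyshev.theta_le_log4_mul_x (Nat.cast_nonneg _)
  have h4 : ∑ p ∈ N.primesLE, ((N : ℝ) / p - 1) * Real.log p
      = N * ∑ p ∈ N.primesLE, Real.log p / p - ∑ p ∈ N.primesLE, Real.log p := by
    rw [Finset.mul_sum, ← Finset.sum_sub_distrib]
    refine Finset.sum_congr rfl fun p _ => by ring
  rw [h4] at h2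
  have : N * ∑ p ∈ N.primesLE, Real.log p / p ≤ N * (Real.log N + Real.log 4) := by linarith
  exact le_of_mul_le_mul_left this hN0

lemma sum_primesLE_succ (f : ℕ → ℝ) (N : ℕ) :
    ∑ p ∈ (N + 1).primesLE, f p
      = ∑ p ∈ N.primesLE, f p + if (N + 1).Prime then f (N + 1) else 0 := by
  have : ∀ M : ℕ, M.primesLE = (Finset.range (M + 1)).filter Nat.Prime := by
    intro M; ext p; simp [Nat.mem_primesLE]
  rw [this, this, Finset.sum_filter, Finset.sum_range_succ, ← Finset.sum_filter]

lemma sum_inv_primesLE_le (N : ℕ) (hN : 2 ≤ N) :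
    ∑ p ∈ N.primesLE, (1 : ℝ) / p ≤ Real.log (Real.log N) + 4 := by
  have hl2 : 0 < Real.log 2 := Real.log_pos (by norm_num)
  have key : ∀ N : ℕ, 2 ≤ N →
      ∑ p ∈ N.primesLE, (1 : ℝ) / p - (∑ p ∈ N.primesLE, Real.log p / p) / Real.log N
      ≤ Real.log (Real.log N) - Real.log (Real.log 2)
        + Real.log 4 * (1 / Real.log 2 - 1 / Real.log N) := by
    intro N hN
    induction N, hN using Nat.le_induction with
    | base =>
      have : Nat.primesLE 2 = {2} := by decide
      rw [this]
      simp
      field_simp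
      norm_num
    | succ n hn ih =>
      have hn' : (1 : ℝ) < n := by exact_mod_cast hn
      have hl : 0 < Real.log n := Real.log_pos hn'
      have hl' : 0 < Real.log (n + 1 : ℕ) := Real.log_pos (by push_cast; linarith)
      have hll : Real.log n ≤ Real.log (n + 1 : ℕ) :=
        Real.log_le_log (by linarith) (by push_cast; linarith)
      have hS := sum_log_div_primesLE_le n (by omega)
      rw [sum_primesLE_succ, sum_primesLE_succ (fun p => Real.log p / p)]
      set H := ∑ p ∈ n.primesLE, (1 : ℝ) / p
      set S := ∑ p ∈ n.primesLE, Real.log p / p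
      set l := Real.log n
      set l' := Real.log (n + 1 : ℕ)
      have e1 : (H + if (n + 1).Prime then (1 : ℝ) / (n + 1 : ℕ) else 0)
          - (S + if (n + 1).Prime then l' / (n + 1 : ℕ) else 0) / l'
          = (H - S / l) + S * (1 / l - 1 / l') := by
        split_ifs
        · field_simp; ring
        · field_simp; ring
      rw [e1]
      have h1 : S * (1 / l - 1 / l') ≤ (l + Real.log 4) * (1 / l - 1 / l') := by
        apply mul_le_mul_of_nonneg_right hS
        rw [sub_nonneg]
        exact one_div_le_one_div_of_le hl hll
      have h2 : 1 - (l' / l)⁻¹ ≤ Real.log l' - Real.log l := by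
        rw [← Real.log_div hl'.ne' hl.ne']
        exact Real.one_sub_inv_le_log_of_pos (by positivity)
      have h3 : (l + Real.log 4) * (1 / l - 1 / l')
          = 1 - (l' / l)⁻¹ + Real.log 4 * (1 / l - 1 / l') := by
        field_simp
      nlinarith
  have hk := key N hN
  have hn' : (1 : ℝ) < N := by exact_mod_cast hN
  have hl : 0 < Real.log N := Real.log_pos hn'
  have hS := sum_log_div_primesLE_le N (by omega)
  have h4 : Real.log 4 = 2 * Real.log 2 := by
    rw [show (4 : ℝ) = 2 ^ 2 by norm_num, Real.log_pow]; norm_num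
  have h5 : (∑ p ∈ N.primesLE, Real.log p / p) / Real.log N ≤ 1 + Real.log 4 / Real.log N := by
    rw [div_le_iff₀ hl]
    field_simp
    linarith
  have h6 : Real.log 4 * (1 / Real.log 2 - 1 / Real.log N) = 2 - Real.log 4 / Real.log N := by
    rw [h4]; field_simp
  have h7 : -1 ≤ Real.log (Real.log 2) := by
    rw [Real.le_log_iff_exp_le hl2]
    have := Real.exp_neg_one_lt_d9
    have := Real.log_two_gt_d9
    linarith
  linarith

lemma log_log_succ_le_sum_inv_primesLE (N : ℕ) (hN : 2 ≤ N) :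
    Real.log (Real.log (N + 1)) - 1 ≤ ∑ p ∈ N.primesLE, (1 : ℝ) / p := by
  let f : ℕ →* ℝ :=
    { toFun := fun n => (n : ℝ)⁻¹
      map_one' := by simp
      map_mul' := by intro a b; push_cast; rw [mul_inv] }
  have hf : ∀ {p : ℕ}, p.Prime → ‖f p‖ < 1 := by
    intro p hp
    have : (1 : ℝ) < p := by exact_mod_cast hp.one_lt
    change ‖(p : ℝ)⁻¹‖ < 1
    rw [norm_inv, Real.norm_natCast]
    exact inv_lt_one_of_one_lt₀ this
  obtain ⟨hs, hsum⟩ :=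
    EulerProduct.summable_and_hasSum_smoothNumbers_prod_primesBelow_geometric hf (N + 1)
  have hpb : (N + 1).primesBelow = N.primesLE := by
    ext p; simp [Nat.mem_primesLE, Nat.mem_primesBelow]
  rw [hpb] at hsum
  have h1 : ((harmonic N : ℚ) : ℝ) ≤ ∏ p ∈ N.primesLE, (1 - f p)⁻¹ := by
    have := hsum.summable.sum_le_tsum
      (((Finset.Icc 1 N).attach).map ⟨fun n => (⟨n.1, by
        have := Finset.mem_Icc.1 n.2
        exact Nat.mem_smoothNumbers_of_lt (by omega) (by omega)⟩ : (N + 1).smoothNumbers),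
        fun a b h => by
          apply Subtype.ext
          simpa using h⟩) (fun i _ => by
            change 0 ≤ ((i : ℕ) : ℝ)⁻¹
            positivity)
    rw [hsum.tsum_eq, Finset.sum_map] at this
    refine le_trans (le_of_eq ?_) this
    change _ = ∑ x ∈ (Finset.Icc 1 N).attach, ((x : ℕ) : ℝ)⁻¹
    rw [Finset.sum_attach (Finset.Icc 1 N) (fun x => (x : ℝ)⁻¹), harmonic_eq_sum_Icc]
    push_cast
    rfl
  have h2 : Real.log (N + 1) ≤ ∏ p ∈ N.primesLE, (1 - f p)⁻¹ := by
    refine le_trans ?_ h1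
    have := log_add_one_le_harmonic N
    push_cast at this
    exact this
  have hNr : (2 : ℝ) ≤ N := by exact_mod_cast hN
  have hl : 0 < Real.log (N + 1) := Real.log_pos (by linarith)
  have hone : ∀ p ∈ N.primesLE, (1 : ℝ) < p := fun p hp => by
    exact_mod_cast (Nat.mem_primesLE.1 hp).2.one_lt
  have h3 : Real.log (Real.log (N + 1)) ≤ ∑ p ∈ N.primesLE, Real.log ((1 - f p)⁻¹) := by
    rw [← Real.log_prod]
    · exact Real.log_le_log hl h2
    · intro p hp
      have := hone p hp
      have h : f p < 1 := by
        change (p : ℝ)⁻¹ < 1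
        exact inv_lt_one_of_one_lt₀ this
      exact inv_ne_zero (by linarith)
  have h4 : ∀ p ∈ N.primesLE, Real.log ((1 - f p)⁻¹) ≤ 1 / p + 1 / (p * (p - 1) : ℝ) := by
    intro p hp
    have hp1 := hone p hp
    have e : (1 - f p)⁻¹ = (p : ℝ) / (p - 1) := by
      change (1 - (p : ℝ)⁻¹)⁻¹ = _
      have : (p : ℝ) - 1 ≠ 0 := by linarith
      have : (p : ℝ) ≠ 0 := by linarith
      rw [← inv_div]
      congr 1
      field_simp
    rw [e]
    have h0 : 0 < (p : ℝ) - 1 := by linarith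
    have := Real.log_le_sub_one_of_pos (show 0 < (p : ℝ) / (p - 1) by positivity)
    refine this.trans (le_of_eq ?_)
    field_simp
    ring
  have h5 : ∑ p ∈ N.primesLE, 1 / (p * (p - 1) : ℝ) ≤ 1 := by
    have : ∑ n ∈ Finset.Icc 2 N, 1 / (n * (n - 1) : ℝ) = 1 - 1 / N := by
      clear * - hN
      induction N, hN using Nat.le_induction with
      | base => norm_num
      | succ n hn ih =>
        rw [Finset.sum_Icc_succ_top (by omega), ih]
        have : (0 : ℝ) < n := by exact_mod_cast (by omega : 0 < n)
        push_cast
        rw [add_sub_cancel_right]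
        field_simp
        ring
    have hle : ∑ p ∈ N.primesLE, 1 / (p * (p - 1) : ℝ)
        ≤ ∑ n ∈ Finset.Icc 2 N, 1 / (n * (n - 1) : ℝ) := by
      apply Finset.sum_le_sum_of_subset_of_nonneg
      · intro p hp
        have := Nat.mem_primesLE.1 hp
        exact Finset.mem_Icc.2 ⟨this.2.two_le, this.1⟩
      · intro n hn _
        have : (2 : ℝ) ≤ n := by exact_mod_cast (Finset.mem_Icc.1 hn).1
        have : (0 : ℝ) ≤ n - 1 := by linarith
        positivity
    have : (0 : ℝ) ≤ 1 / N := by positivity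
    linarith
  have h6 := h3.trans (Finset.sum_le_sum h4)
  rw [Finset.sum_add_distrib] at h6
  linarith

lemma primesBetween_sum {a b : ℝ} (hab : a ≤ b) (f : ℕ → ℝ) :
    ∑ p ∈ primesBetween a b, f p
      = ∑ p ∈ (⌊b⌋₊).primesLE, f p - ∑ p ∈ (⌊a⌋₊).primesLE, f p := by
  have hsub : (⌊a⌋₊).primesLE ⊆ (⌊b⌋₊).primesLE := by
    intro p hp
    rw [Nat.mem_primesLE] at *
    exact ⟨hp.1.trans (Nat.floor_mono hab), hp.2⟩
  rw [eq_sub_iff_add_eq, ← Finset.sum_sdiff hsub]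
  congr 1
  refine Finset.sum_congr ?_ fun _ _ => rfl
  ext p
  simp only [primesBetween, Finset.mem_filter, Finset.mem_Ioc, Finset.mem_sdiff, Nat.mem_primesLE]
  constructor
  · rintro ⟨⟨h1, h2⟩, h3⟩; exact ⟨⟨h2, h3⟩, by omega⟩
  · rintro ⟨⟨h1, h2⟩, h3⟩
    refine ⟨⟨?_, h1⟩, h2⟩
    by_contra h
    exact h3 ⟨by omega, h2⟩

/-- Mertens' second theorem with a bounded error term. -/
lemma abs_sum_inv_primesBetween_sub_le {a b : ℝ} (ha : 2 ≤ a) (hab : a ≤ b) :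
    |∑ p ∈ primesBetween a b, (1 : ℝ) / p - (Real.log (Real.log b) - Real.log (Real.log a))|
      ≤ 5 := by
  have hfl : ∀ {c : ℝ}, 2 ≤ c →
      Real.log (Real.log c) - 1 ≤ ∑ p ∈ (⌊c⌋₊).primesLE, (1 : ℝ) / p ∧
      ∑ p ∈ (⌊c⌋₊).primesLE, (1 : ℝ) / p ≤ Real.log (Real.log c) + 4 := by
    intro c hc
    have h2 : 2 ≤ ⌊c⌋₊ := Nat.le_floor (by exact_mod_cast hc)
    have h2r : (2 : ℝ) ≤ ⌊c⌋₊ := by exact_mod_cast h2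
    have hlow := log_log_succ_le_sum_inv_primesLE _ h2
    have hup := sum_inv_primesLE_le _ h2
    have h3 := Nat.lt_floor_add_one c
    have h4 := Nat.floor_le (show 0 ≤ c by linarith)
    have h5 : Real.log (Real.log c) ≤ Real.log (Real.log (⌊c⌋₊ + 1)) :=
      Real.log_le_log (Real.log_pos (by linarith)) (Real.log_le_log (by linarith) h3.le)
    have h6 : Real.log (Real.log ⌊c⌋₊) ≤ Real.log (Real.log c) :=
      Real.log_le_log (Real.log_pos (by linarith)) (Real.log_le_log (by linarith) h4)
    constructor <;> linarith
  rw [primesBetween_sum hab, abs_le]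
  have h1 := hfl ha
  have h2 := hfl (ha.trans hab)
  constructor <;> linarith [h1.1, h1.2, h2.1, h2.2]

/-- The number of elements of `S` dividing `n`. -/
def divCount (S : Finset ℕ) (n : ℕ) : ℕ := (S.filter (· ∣ n)).card

lemma divCount_eq_sum (S : Finset ℕ) (n : ℕ) :
    (divCount S n : ℝ) = ∑ p ∈ S, if p ∣ n then (1 : ℝ) else 0 := by
  unfold divCount
  rw [Finset.card_filter]
  push_cast
  rfl

lemma card_Icc_filter_dvd (N p : ℕ) :
    ((Finset.Icc 1 N).filter (p ∣ ·)).card = N / p := by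
  rw [← Nat.Ioc_filter_dvd_card_eq_div]
  rfl

lemma turan_second_moment (S : Finset ℕ) (hS : ∀ p ∈ S, p.Prime) (N : ℕ) (hN : S.card ≤ N) :
    ∑ n ∈ Finset.Icc 1 N, ((divCount S n : ℝ) - ∑ p ∈ S, (1 : ℝ) / p) ^ 2
      ≤ 3 * N * ∑ p ∈ S, (1 : ℝ) / p := by
  set L := ∑ p ∈ S, (1 : ℝ) / p with hL
  have hL0 : 0 ≤ L := Finset.sum_nonneg fun p _ => by positivity
  have hcount : ∀ p : ℕ, ∑ n ∈ Finset.Icc 1 N, (if p ∣ n then (1 : ℝ) else 0) = (N / p : ℕ) := by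
    intro p
    rw [← card_Icc_filter_dvd, Finset.card_filter]
    push_cast
    rfl
  have h1 : (N : ℝ) * L - S.card ≤ ∑ n ∈ Finset.Icc 1 N, (divCount S n : ℝ) := by
    simp_rw [divCount_eq_sum]
    rw [Finset.sum_comm]
    simp_rw [hcount]
    rw [hL, Finset.mul_sum, Finset.card_eq_sum_ones]
    push_cast
    rw [← Finset.sum_sub_distrib]
    refine Finset.sum_le_sum fun p _ => ?_
    have := Nat.lt_floor_add_one ((N : ℝ) / p)
    rw [Nat.floor_div_natCast, Nat.floor_natCast] at this
    rw [mul_one_div]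
    linarith
  have h2 : ∑ n ∈ Finset.Icc 1 N, (divCount S n : ℝ) ^ 2 ≤ N * L ^ 2 + N * L := by
    have e : ∀ n, (divCount S n : ℝ) ^ 2
        = ∑ p ∈ S, ∑ q ∈ S, if p ∣ n ∧ q ∣ n then (1 : ℝ) else 0 := by
      intro n
      rw [divCount_eq_sum, sq, Finset.sum_mul_sum]
      refine Finset.sum_congr rfl fun p _ => Finset.sum_congr rfl fun q _ => ?_
      by_cases hp : p ∣ n <;> by_cases hq : q ∣ n <;> simp [hp, hq]
    simp_rw [e]
    rw [Finset.sum_comm]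
    have : ∀ p ∈ S, ∑ n ∈ Finset.Icc 1 N, ∑ q ∈ S, (if p ∣ n ∧ q ∣ n then (1 : ℝ) else 0)
        ≤ N * (1 / p * L) + N * (1 / p) := by
      intro p hp
      rw [Finset.sum_comm]
      have hb : ∀ q ∈ S, ∑ n ∈ Finset.Icc 1 N, (if p ∣ n ∧ q ∣ n then (1 : ℝ) else 0)
          ≤ N * (1 / p * (1 / q)) + if q = p then N * (1 / p : ℝ) else 0 := by
        intro q hq
        by_cases hqp : q = p
        · subst hqp
          simp only [and_self, if_true]
          rw [hcount]
          have := Nat.cast_div_le (α := ℝ) (m := N) (n := q)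
          have : (0 : ℝ) ≤ N * (1 / q * (1 / q)) := by positivity
          rw [mul_one_div (N : ℝ) (q : ℝ)]
          linarith
        · rw [if_neg hqp, add_zero]
          have hc : Nat.Coprime p q := (Nat.coprime_primes (hS p hp) (hS q hq)).2 (Ne.symm hqp)
          have : ∀ n, (if p ∣ n ∧ q ∣ n then (1 : ℝ) else 0) = if p * q ∣ n then 1 else 0 := by
            intro n
            congr 1
            exact propext ⟨fun h => hc.mul_dvd_of_dvd_of_dvd h.1 h.2,
              fun h => ⟨(dvd_mul_right _ _).trans h, (dvd_mul_left _ _).trans h⟩⟩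
          simp_rw [this, hcount]
          refine Nat.cast_div_le.trans (le_of_eq ?_)
          push_cast
          rw [div_mul_div_comm, one_mul, mul_one_div]
      refine (Finset.sum_le_sum hb).trans (le_of_eq ?_)
      rw [Finset.sum_add_distrib, ← Finset.mul_sum, ← Finset.mul_sum, Finset.sum_ite_eq' S p,
        if_pos hp]
    refine (Finset.sum_le_sum this).trans (le_of_eq ?_)
    rw [Finset.sum_add_distrib, ← Finset.mul_sum, ← Finset.mul_sum, ← Finset.sum_mul, ← hL]
    ring
  have h3 : ∑ n ∈ Finset.Icc 1 N, ((divCount S n : ℝ) - L) ^ 2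
      = ∑ n ∈ Finset.Icc 1 N, (divCount S n : ℝ) ^ 2
        - 2 * L * ∑ n ∈ Finset.Icc 1 N, (divCount S n : ℝ) + N * L ^ 2 := by
    simp_rw [sub_sq]
    rw [Finset.sum_add_distrib, Finset.sum_sub_distrib, Finset.mul_sum]
    simp only [Finset.sum_const, Nat.card_Icc, nsmul_eq_mul, Nat.add_sub_cancel]
    congr 2
    refine Finset.sum_congr rfl fun n _ => by ring
  rw [h3]
  have h4 : (S.card : ℝ) ≤ N := by exact_mod_cast hN
  nlinarith [mul_le_mul_of_nonneg_left h1 hL0, mul_le_mul_of_nonneg_left h4 hL0]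

lemma sum_Icc_dvd_eq {E : Type*} [AddCommMonoid E] (N p : ℕ) (hp : 0 < p) (f : ℕ → E) :
    ∑ m ∈ Finset.Icc 1 (N / p), f (p * m) = ∑ n ∈ (Finset.Icc 1 N).filter (p ∣ ·), f n := by
  refine Finset.sum_bij (fun m _ => p * m) ?_ ?_ ?_ ?_
  · intro m hm
    rw [Finset.mem_Icc] at hm
    rw [Finset.mem_filter, Finset.mem_Icc]
    refine ⟨⟨Nat.mul_pos hp hm.1, ?_⟩, dvd_mul_right _ _⟩
    rw [mul_comm]
    exact (Nat.le_div_iff_mul_le hp).1 hm.2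
  · intro a _ b _ h
    exact Nat.eq_of_mul_eq_mul_left hp h
  · intro n hn
    rw [Finset.mem_filter, Finset.mem_Icc] at hn
    obtain ⟨⟨h1, h2⟩, m, rfl⟩ := hn
    refine ⟨m, ?_, rfl⟩
    rw [Finset.mem_Icc, Nat.le_div_iff_mul_le hp]
    exact ⟨Nat.pos_of_mul_pos_left h1, by rwa [mul_comm]⟩
  · intro _ _; rfl

/-- Averages of a bounded function over `[1, N]` are close to averages over multiples of a prime
in `S`. -/
lemma norm_sum_sub_prime_average_le {E : Type*} [NormedAddCommGroup E] [NormedSpace ℝ E]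
    (S : Finset ℕ) (hS : ∀ p ∈ S, p.Prime) (N : ℕ) (hN : S.card ≤ N)
    (hL : 0 < ∑ p ∈ S, (1 : ℝ) / p) (f : ℕ → E) (hf : ∀ n, ‖f n‖ ≤ 1) :
    ‖∑ n ∈ Finset.Icc 1 N, f n
        - (∑ p ∈ S, (1 : ℝ) / p)⁻¹ • ∑ p ∈ S, ∑ m ∈ Finset.Icc 1 (N / p), f (p * m)‖
      ≤ N * √(3 / ∑ p ∈ S, (1 : ℝ) / p) := by
  have h2 := turan_second_moment S hS N hN
  set L := ∑ p ∈ S, (1 : ℝ) / p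
  have e1 : ∑ p ∈ S, ∑ m ∈ Finset.Icc 1 (N / p), f (p * m)
      = ∑ n ∈ Finset.Icc 1 N, (divCount S n : ℝ) • f n := by
    rw [Finset.sum_congr rfl fun p hp => sum_Icc_dvd_eq N p (hS p hp).pos f]
    simp_rw [Finset.sum_filter]
    rw [Finset.sum_comm]
    refine Finset.sum_congr rfl fun n _ => ?_
    rw [divCount_eq_sum, Finset.sum_smul]
    refine Finset.sum_congr rfl fun p _ => ?_
    split_ifs <;> simp
  have e2 : ∑ n ∈ Finset.Icc 1 N, f n
        - L⁻¹ • ∑ p ∈ S, ∑ m ∈ Finset.Icc 1 (N / p), f (p * m)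
      = ∑ n ∈ Finset.Icc 1 N, (1 - L⁻¹ * (divCount S n : ℝ)) • f n := by
    rw [e1, Finset.smul_sum, ← Finset.sum_sub_distrib]
    refine Finset.sum_congr rfl fun n _ => ?_
    rw [sub_smul, one_smul, mul_smul]
  rw [e2]
  have h3 : ∑ n ∈ Finset.Icc 1 N, |1 - L⁻¹ * (divCount S n : ℝ)| ≤ N * √(3 / L) := by
    apply le_of_sq_le_sq _ (by positivity)
    have hcs := sq_sum_le_card_mul_sum_sq (s := Finset.Icc 1 N)
      (f := fun n => |1 - L⁻¹ * (divCount S n : ℝ)|)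
    refine hcs.trans ?_
    simp only [sq_abs, Nat.card_Icc, Nat.add_sub_cancel]
    rw [mul_pow, Real.sq_sqrt (by positivity), sq, mul_assoc]
    refine mul_le_mul_of_nonneg_left ?_ (Nat.cast_nonneg _)
    have e3 : ∑ n ∈ Finset.Icc 1 N, (1 - L⁻¹ * (divCount S n : ℝ)) ^ 2
        = (L⁻¹) ^ 2 * ∑ n ∈ Finset.Icc 1 N, ((divCount S n : ℝ) - L) ^ 2 := by
      rw [Finset.mul_sum]
      refine Finset.sum_congr rfl fun n _ => ?_
      field_simp
      ring
    rw [e3]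
    calc (L⁻¹) ^ 2 * ∑ n ∈ Finset.Icc 1 N, ((divCount S n : ℝ) - L) ^ 2
        ≤ (L⁻¹) ^ 2 * (3 * N * L) := mul_le_mul_of_nonneg_left h2 (by positivity)
      _ = N * (3 / L) := by field_simp
  refine (norm_sum_le _ _).trans (le_trans (Finset.sum_le_sum fun n _ => ?_) h3)
  rw [norm_smul, Real.norm_eq_abs]
  exact mul_le_of_le_one_right (abs_nonneg _) (hf n)

/-- The average of `f` over integers `p * q * m ≤ N`, with `p ∈ P` and `q ∈ Q`, normalised by
the reciprocal sums of `P` and `Q`. -/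
noncomputable def bilinearAverage {E : Type*} [NormedAddCommGroup E] [NormedSpace ℝ E]
    (P Q : Finset ℕ) (N : ℕ) (f : ℕ → E) : E :=
  ((∑ p ∈ P, (1 : ℝ) / p)⁻¹ * (∑ q ∈ Q, (1 : ℝ) / q)⁻¹) •
    ∑ p ∈ P, ∑ q ∈ Q, ∑ m ∈ Finset.Icc 1 (N / p / q), f (p * (q * m))

lemma norm_sum_sub_bilinearAverage_le {E : Type*} [NormedAddCommGroup E] [NormedSpace ℝ E]
    (P Q : Finset ℕ) (hP : ∀ p ∈ P, p.Prime) (hQ : ∀ q ∈ Q, q.Prime) (N : ℕ) (hPN : P.card ≤ N)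
    (hQN : ∀ p ∈ P, Q.card ≤ N / p)
    (hLP : 0 < ∑ p ∈ P, (1 : ℝ) / p) (hLQ : 0 < ∑ q ∈ Q, (1 : ℝ) / q)
    (f : ℕ → E) (hf : ∀ n, ‖f n‖ ≤ 1) :
    ‖∑ n ∈ Finset.Icc 1 N, f n - bilinearAverage P Q N f‖
      ≤ N * (√(3 / ∑ p ∈ P, (1 : ℝ) / p) + √(3 / ∑ q ∈ Q, (1 : ℝ) / q)) := by
  have h1 := norm_sum_sub_prime_average_le P hP N hPN hLP f hf
  have h2 : ∀ p ∈ P, _ := fun p hp =>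
    norm_sum_sub_prime_average_le Q hQ (N / p) (hQN p hp) hLQ (fun n => f (p * n))
      (fun n => hf _)
  unfold bilinearAverage
  set LP := ∑ p ∈ P, (1 : ℝ) / p with hLPdef
  set LQ := ∑ q ∈ Q, (1 : ℝ) / q
  have h3 : ‖LP⁻¹ • ∑ p ∈ P, ∑ m ∈ Finset.Icc 1 (N / p), f (p * m)
      - (LP⁻¹ * LQ⁻¹) • ∑ p ∈ P, ∑ q ∈ Q, ∑ m ∈ Finset.Icc 1 (N / p / q), f (p * (q * m))‖
      ≤ N * √(3 / LQ) := by
    rw [mul_smul, ← smul_sub, Finset.smul_sum, ← Finset.sum_sub_distrib, norm_smul, norm_inv,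
      Real.norm_of_nonneg hLP.le, inv_mul_le_iff₀ hLP]
    refine (norm_sum_le _ _).trans ((Finset.sum_le_sum h2).trans ?_)
    rw [hLPdef, Finset.sum_mul]
    refine Finset.sum_le_sum fun p hp => ?_
    calc ((N / p : ℕ) : ℝ) * √(3 / LQ) ≤ (N / p : ℝ) * √(3 / LQ) :=
          mul_le_mul_of_nonneg_right Nat.cast_div_le (Real.sqrt_nonneg _)
      _ = _ := by ring
  calc _ ≤ _ := norm_sub_le_norm_sub_add_norm_sub _ _ _
    _ ≤ _ := add_le_add h1 h3
    _ = _ := by ring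

lemma abs_card_modEq_sub_le (Y v r : ℕ) (hr : 0 < r) :
    |(((Finset.Icc 1 Y).filter (· ≡ v [MOD r])).card : ℝ) - (Y : ℝ) / r| ≤ 1 := by
  have h := Nat.Ioc_filter_modEq_card 0 Y hr v
  have hr' : (0 : ℚ) < r := by exact_mod_cast hr
  have e : ((Finset.Icc 1 Y).filter (· ≡ v [MOD r])) = (Finset.Ioc 0 Y).filter (· ≡ v [MOD r]) :=
    rfl
  rw [e]
  have hmono : ⌊(((0 : ℕ) : ℚ) - v) / r⌋ ≤ ⌊((Y : ℚ) - v) / r⌋ := by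
    apply Int.floor_mono
    gcongr
    exact Nat.zero_le _
  rw [max_eq_left (by linarith)] at h
  have h1 := Int.floor_le (((Y : ℚ) - v) / r)
  have h2 := Int.lt_floor_add_one (((Y : ℚ) - v) / r)
  have h3 := Int.floor_le ((((0 : ℕ) : ℚ) - v) / r)
  have h4 := Int.lt_floor_add_one ((((0 : ℕ) : ℚ) - v) / r)
  have hq : (((Finset.Ioc 0 Y).filter (· ≡ v [MOD r])).card : ℚ)
      = ⌊((Y : ℚ) - v) / r⌋ - ⌊(((0 : ℕ) : ℚ) - v) / r⌋ := by exact_mod_cast h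
  have e3 : ((Y : ℚ) - v) / r - (((0 : ℕ) : ℚ) - v) / r = Y / r := by
    push_cast; ring
  have : |(((Finset.Ioc 0 Y).filter (· ≡ v [MOD r])).card : ℚ) - (Y : ℚ) / r| ≤ 1 := by
    rw [abs_le]
    constructor <;> linarith
  have := (Rat.cast_le (K := ℝ)).2 this
  push_cast at this
  exact this

/-- The indicator that `d` divides `a`. -/
def dvdInd (d a : ℕ) : ℝ := if d ∣ a then 1 else 0

lemma dvdInd_nonneg (d a : ℕ) : 0 ≤ dvdInd d a := by
  unfold dvdInd; split_ifs <;> norm_num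

lemma dvd_add_iff_modEq {d b l v : ℕ} (hv : d ∣ b + v) : d ∣ b + l ↔ l ≡ v [MOD d] := by
  have hv' : b + v ≡ 0 [MOD d] := (Nat.modEq_zero_iff_dvd).2 hv
  rw [← Nat.modEq_zero_iff_dvd]
  constructor
  · intro h
    exact Nat.ModEq.add_left_cancel' b (h.trans hv'.symm)
  · intro h
    exact (Nat.ModEq.add_left b h).trans hv'

lemma exists_dvd_add {d : ℕ} (hd : 0 < d) (b : ℕ) : ∃ v, d ∣ b + v :=
  ⟨d * b - b, by
    have : b ≤ d * b := Nat.le_mul_of_pos_left b hd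
    rw [Nat.add_sub_cancel' this]
    exact dvd_mul_right _ _⟩

lemma abs_sum_dvdInd_sub_le (Y d b : ℕ) (hd : 0 < d) :
    |∑ l ∈ Finset.Icc 1 Y, dvdInd d (b + l) - (Y : ℝ) / d| ≤ 1 := by
  obtain ⟨v, hv⟩ := exists_dvd_add hd b
  have := abs_card_modEq_sub_le Y v d hd
  rw [Finset.card_filter] at this
  push_cast at this
  simp only [dvdInd, dvd_add_iff_modEq hv]
  exact this

lemma abs_sum_dvdInd_mul_sub_le (Y d d' b b' l₀ : ℕ) (hd : 0 < d) (hd' : 0 < d')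
    (h : d ∣ b + l₀) (h' : d' ∣ b' + l₀) :
    |∑ l ∈ Finset.Icc 1 Y, dvdInd d (b + l) * dvdInd d' (b' + l)
      - (Y : ℝ) / (Nat.lcm d d' : ℕ)| ≤ 1 := by
  have := abs_card_modEq_sub_le Y l₀ (Nat.lcm d d') (Nat.lcm_pos hd hd')
  rw [Finset.card_filter] at this
  push_cast at this
  have e : ∀ l, dvdInd d (b + l) * dvdInd d' (b' + l)
      = if l ≡ l₀ [MOD Nat.lcm d d'] then 1 else 0 := by
    intro l
    have : l ≡ l₀ [MOD Nat.lcm d d'] ↔ (d ∣ b + l ∧ d' ∣ b' + l) := by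
      rw [dvd_add_iff_modEq h, dvd_add_iff_modEq h', Nat.modEq_iff_dvd, Nat.modEq_iff_dvd,
        Nat.modEq_iff_dvd]
      rw [Int.natCast_dvd, Int.natCast_dvd, Int.natCast_dvd, Nat.lcm_dvd_iff]
    rw [if_congr this rfl rfl]
    by_cases h1 : d ∣ b + l <;> by_cases h2 : d' ∣ b' + l <;> simp [dvdInd, h1, h2]
  simp_rw [e]
  exact this

/-- The correlation sum of two centred divisibility indicators. -/
noncomputable def dvdCorr (Y d d' b b' : ℕ) : ℝ :=
  ∑ l ∈ Finset.Icc 1 Y, (dvdInd d (b + l) - 1 / d) * (dvdInd d' (b' + l) - 1 / d')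

lemma abs_dvdCorr_sub_le (Y d d' b b' : ℕ) (hd : 0 < d) (hd' : 0 < d') :
    |dvdCorr Y d d' b b' - (∑ l ∈ Finset.Icc 1 Y, dvdInd d (b + l) * dvdInd d' (b' + l)
      - (Y : ℝ) / (d * d'))| ≤ 2 := by
  have h1 := abs_sum_dvdInd_sub_le Y d b hd
  have h2 := abs_sum_dvdInd_sub_le Y d' b' hd'
  have hd1 : (1 : ℝ) ≤ d := by exact_mod_cast hd
  have hd1' : (1 : ℝ) ≤ d' := by exact_mod_cast hd'
  have e : dvdCorr Y d d' b b' - (∑ l ∈ Finset.Icc 1 Y, dvdInd d (b + l) * dvdInd d' (b' + l)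
      - (Y : ℝ) / (d * d'))
      = - (∑ l ∈ Finset.Icc 1 Y, dvdInd d (b + l) - (Y : ℝ) / d) * (1 / d')
        - (∑ l ∈ Finset.Icc 1 Y, dvdInd d' (b' + l) - (Y : ℝ) / d') * (1 / d) := by
    have : dvdCorr Y d d' b b' = ∑ l ∈ Finset.Icc 1 Y, dvdInd d (b + l) * dvdInd d' (b' + l)
        - (∑ l ∈ Finset.Icc 1 Y, dvdInd d (b + l)) * (1 / d')
        - (∑ l ∈ Finset.Icc 1 Y, dvdInd d' (b' + l)) * (1 / d) + Y * (1 / d * (1 / d')) := by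
      have : (Y : ℝ) * (1 / d * (1 / d')) = ∑ l ∈ Finset.Icc 1 Y, (1 / (d : ℝ) * (1 / d')) := by
        simp
      rw [this, Finset.sum_mul, Finset.sum_mul, ← Finset.sum_sub_distrib,
        ← Finset.sum_sub_distrib, ← Finset.sum_add_distrib]
      refine Finset.sum_congr rfl fun l _ => by ring
    rw [this]
    field_simp
    ring
  rw [e]
  have hb : 0 ≤ 1 / (d : ℝ) ∧ 1 / (d : ℝ) ≤ 1 :=
    ⟨by positivity, by rw [div_le_one (by linarith)]; exact hd1⟩
  have hb' : 0 ≤ 1 / (d' : ℝ) ∧ 1 / (d' : ℝ) ≤ 1 :=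
    ⟨by positivity, by rw [div_le_one (by linarith)]; exact hd1'⟩
  set X := ∑ l ∈ Finset.Icc 1 Y, dvdInd d (b + l) - (Y : ℝ) / d
  set Z := ∑ l ∈ Finset.Icc 1 Y, dvdInd d' (b' + l) - (Y : ℝ) / d'
  calc |-X * (1 / d') - Z * (1 / d)| ≤ |-X * (1 / d')| + |Z * (1 / d)| := abs_sub _ _
    _ ≤ 1 * 1 + 1 * 1 := by
      rw [abs_mul, abs_mul, abs_neg, abs_of_nonneg hb.1, abs_of_nonneg hb'.1]
      exact add_le_add (mul_le_mul h1 hb'.2 hb'.1 zero_le_one)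
        (mul_le_mul h2 hb.2 hb.1 zero_le_one)
    _ = 2 := by norm_num

lemma abs_dvdCorr_le_lcm (Y d d' b b' : ℕ) (hd : 0 < d) (hd' : 0 < d') :
    |dvdCorr Y d d' b b'| ≤ Y / (Nat.lcm d d' : ℕ) + 3 := by
  have h := abs_le.1 (abs_dvdCorr_sub_le Y d d' b b' hd hd')
  have hl : 0 < Nat.lcm d d' := Nat.lcm_pos hd hd'
  have hlcm : (Y : ℝ) / (d * d') ≤ Y / (Nat.lcm d d' : ℕ) := by
    apply div_le_div_of_nonneg_left (Nat.cast_nonneg _) (by exact_mod_cast hl)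
    exact_mod_cast Nat.lcm_le_mul hd hd'
  have h0 : (0 : ℝ) ≤ (Y : ℝ) / (d * d') := by positivity
  have hJ0 : 0 ≤ ∑ l ∈ Finset.Icc 1 Y, dvdInd d (b + l) * dvdInd d' (b' + l) :=
    Finset.sum_nonneg fun l _ => mul_nonneg (dvdInd_nonneg _ _) (dvdInd_nonneg _ _)
  have hJ : ∑ l ∈ Finset.Icc 1 Y, dvdInd d (b + l) * dvdInd d' (b' + l)
      ≤ Y / (Nat.lcm d d' : ℕ) + 1 := by
    by_cases hex : ∃ l₀, d ∣ b + l₀ ∧ d' ∣ b' + l₀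
    · obtain ⟨l₀, h1, h2⟩ := hex
      have := abs_le.1 (abs_sum_dvdInd_mul_sub_le Y d d' b b' l₀ hd hd' h1 h2)
      linarith
    · push Not at hex
      rw [Finset.sum_eq_zero]
      · positivity
      · intro l _
        by_cases h1 : d ∣ b + l
        · simp [dvdInd, hex l h1]
        · simp [dvdInd, h1]
  rw [abs_le]
  constructor <;> linarith

lemma abs_dvdCorr_le_of_coprime (Y d d' b b' : ℕ) (hd : 0 < d) (hd' : 0 < d')
    (hc : Nat.Coprime d d') : |dvdCorr Y d d' b b'| ≤ 3 := by
  have h := abs_le.1 (abs_dvdCorr_sub_le Y d d' b b' hd hd')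
  obtain ⟨v, hv⟩ := exists_dvd_add hd b
  obtain ⟨v', hv'⟩ := exists_dvd_add hd' b'
  obtain ⟨k, hk, hk'⟩ := Nat.chineseRemainder hc v v'
  have := abs_le.1 (abs_sum_dvdInd_mul_sub_le Y d d' b b' k hd hd'
    ((dvd_add_iff_modEq hv).2 hk) ((dvd_add_iff_modEq hv').2 hk'))
  rw [hc.lcm_eq_mul] at this
  push_cast at this
  rw [abs_le]
  constructor <;> linarith

lemma abs_dvdCorr_le_of_gcd (Y d d' b q q' : ℕ) (hd : 0 < d) (hd' : 0 < d') (R : ℝ)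
    (hR : 0 < R) (hq : (q : ℝ) ≤ R) (hq' : (q' : ℝ) ≤ R) (hne : q ≠ q')
    (hg : R < Nat.gcd d d') :
    |dvdCorr Y d d' (b + q) (b + q')| ≤ Y / (Nat.lcm d d' : ℕ) / R + 3 := by
  have h := abs_le.1 (abs_dvdCorr_sub_le Y d d' (b + q) (b + q') hd hd')
  have hJ : ∑ l ∈ Finset.Icc 1 Y, dvdInd d (b + q + l) * dvdInd d' (b + q' + l) = 0 := by
    apply Finset.sum_eq_zero
    intro l _
    by_contra hcon
    have h1 : d ∣ b + q + l := by
      by_contra h1; simp [dvdInd, h1] at hcon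
    have h2 : d' ∣ b + q' + l := by
      by_contra h2; simp [dvdInd, h2] at hcon
    have h3 := (Nat.gcd_dvd_left d d').trans h1
    have h4 := (Nat.gcd_dvd_right d d').trans h2
    have h5 : ((Nat.gcd d d' : ℕ) : ℤ) ∣ (q : ℤ) - q' := by
      have e : (q : ℤ) - q' = ((b + q + l : ℕ) : ℤ) - ((b + q' + l : ℕ) : ℤ) := by
        push_cast; ring
      rw [e]
      exact dvd_sub (Int.natCast_dvd_natCast.2 h3) (Int.natCast_dvd_natCast.2 h4)
    have h6 := Int.le_of_dvd (a := (Nat.gcd d d' : ℕ)) (b := |(q : ℤ) - q'|)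
      (abs_pos.2 (sub_ne_zero.2 (by exact_mod_cast hne))) ((dvd_abs _ _).2 h5)
    have h7 : ((Nat.gcd d d' : ℕ) : ℝ) ≤ |(q : ℝ) - q'| := by exact_mod_cast h6
    have h8 : |(q : ℝ) - q'| ≤ R := by
      have := Nat.cast_nonneg (α := ℝ) q
      have := Nat.cast_nonneg (α := ℝ) q'
      rw [abs_le]; constructor <;> linarith
    linarith
  have hlp : (0 : ℝ) < (Nat.lcm d d' : ℕ) := by exact_mod_cast Nat.lcm_pos hd hd'
  have hlcm : (Y : ℝ) / (d * d') ≤ Y / (Nat.lcm d d' : ℕ) / R := by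
    rw [div_div]
    apply div_le_div_of_nonneg_left (Nat.cast_nonneg _) (by positivity)
    have := Nat.gcd_mul_lcm d d'
    have e : (d : ℝ) * d' = (Nat.gcd d d' : ℕ) * (Nat.lcm d d' : ℕ) := by exact_mod_cast this.symm
    rw [e, mul_comm]
    exact mul_le_mul_of_nonneg_right hg.le hlp.le
  have h0 : (0 : ℝ) ≤ (Y : ℝ) / (d * d') := by positivity
  rw [hJ] at h
  rw [abs_le]
  constructor <;> linarith

lemma sum_inv_lcm_le (D : ℕ) (s : Finset ℕ) (hs : ∀ d ∈ s, 1 ≤ d ∧ d ≤ D) :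
    ∑ d ∈ s, ∑ d' ∈ s, (1 : ℝ) / (Nat.lcm d d' : ℕ) ≤ (1 + Real.log D) ^ 3 := by
  have hH : ∑ n ∈ Finset.Icc 1 D, (1 : ℝ) / n ≤ 1 + Real.log D := by
    have := harmonic_le_one_add_log D
    rw [harmonic_eq_sum_Icc] at this
    push_cast at this
    simpa using this
  have hH0 : 0 ≤ ∑ n ∈ Finset.Icc 1 D, (1 : ℝ) / n := Finset.sum_nonneg fun _ _ => by positivity
  refine le_trans ?_ (pow_le_pow_left₀ hH0 hH 3)
  rw [← Finset.sum_product']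
  let e : ℕ × ℕ → ℕ × ℕ × ℕ := fun x =>
    (Nat.gcd x.1 x.2, x.1 / Nat.gcd x.1 x.2, x.2 / Nat.gcd x.1 x.2)
  have hinj : Set.InjOn e (s ×ˢ s : Finset (ℕ × ℕ)) := by
    rintro ⟨a, b⟩ _ ⟨a', b'⟩ _ h
    simp only [e, Prod.mk.injEq] at h
    obtain ⟨h1, h2, h3⟩ := h
    have ha := Nat.mul_div_cancel' (Nat.gcd_dvd_left a b)
    have hb := Nat.mul_div_cancel' (Nat.gcd_dvd_right a b)
    have ha' := Nat.mul_div_cancel' (Nat.gcd_dvd_left a' b')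
    have hb' := Nat.mul_div_cancel' (Nat.gcd_dvd_right a' b')
    rw [Prod.mk.injEq]
    exact ⟨by rw [← ha, ← ha', h2, h1], by rw [← hb, ← hb', h3, h1]⟩
  let w : ℕ × ℕ × ℕ → ℝ := fun t => 1 / t.1 * (1 / t.2.1 * (1 / t.2.2))
  have e1 : ∑ x ∈ s ×ˢ s, (1 : ℝ) / (Nat.lcm x.1 x.2 : ℕ) = ∑ t ∈ (s ×ˢ s).image e, w t := by
    rw [Finset.sum_image hinj]
    refine Finset.sum_congr rfl fun x hx => ?_
    rw [Finset.mem_product] at hx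
    have h1 := (hs _ hx.1).1
    have hg : 0 < Nat.gcd x.1 x.2 := Nat.gcd_pos_of_pos_left _ h1
    have hm := Nat.gcd_mul_lcm x.1 x.2
    have : Nat.lcm x.1 x.2
        = Nat.gcd x.1 x.2 * ((x.1 / Nat.gcd x.1 x.2) * (x.2 / Nat.gcd x.1 x.2)) := by
      apply Nat.eq_of_mul_eq_mul_left hg
      rw [hm]
      nth_rewrite 1 [← Nat.mul_div_cancel' (Nat.gcd_dvd_left x.1 x.2)]
      nth_rewrite 3 [← Nat.mul_div_cancel' (Nat.gcd_dvd_right x.1 x.2)]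
      ring
    rw [this]
    simp only [w, e]
    push_cast
    rw [one_div_mul_one_div, one_div_mul_one_div]
  rw [e1]
  have hsub : (s ×ˢ s).image e ⊆ Finset.Icc 1 D ×ˢ (Finset.Icc 1 D ×ˢ Finset.Icc 1 D) := by
    intro t ht
    obtain ⟨x, hx, rfl⟩ := Finset.mem_image.1 ht
    rw [Finset.mem_product] at hx
    have h1 := hs _ hx.1
    have h2 := hs _ hx.2
    have hg : 0 < Nat.gcd x.1 x.2 := Nat.gcd_pos_of_pos_left _ h1.1
    have hgl := Nat.gcd_le_left x.2 h1.1
    have hgr := Nat.gcd_le_right x.1 h2.1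
    simp only [e, Finset.mem_product, Finset.mem_Icc]
    exact ⟨⟨hg, hgl.trans h1.2⟩, ⟨Nat.div_pos hgl hg, (Nat.div_le_self _ _).trans h1.2⟩,
      ⟨Nat.div_pos hgr hg, (Nat.div_le_self _ _).trans h2.2⟩⟩
  refine (Finset.sum_le_sum_of_subset_of_nonneg hsub fun t _ _ => by positivity).trans
    (le_of_eq ?_)
  rw [Finset.sum_product]
  simp_rw [Finset.sum_product, w]
  simp_rw [← Finset.mul_sum, ← Finset.sum_mul]
  ring

/-- A linear combination of centred divisibility indicators. -/
noncomputable def centredSum (c : ℕ → ℝ) (s : Finset ℕ) (a : ℕ) : ℝ :=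
  ∑ d ∈ s, c d * (dvdInd d a - 1 / d)

lemma sum_centredSum_mul (c : ℕ → ℝ) (s : Finset ℕ) (Y b b' : ℕ) :
    ∑ l ∈ Finset.Icc 1 Y, centredSum c s (b + l) * centredSum c s (b' + l)
      = ∑ d ∈ s, ∑ d' ∈ s, c d * c d' * dvdCorr Y d d' b b' := by
  unfold centredSum dvdCorr
  simp_rw [Finset.sum_mul_sum, Finset.mul_sum]
  rw [Finset.sum_comm]
  refine Finset.sum_congr rfl fun d _ => ?_
  rw [Finset.sum_comm]
  refine Finset.sum_congr rfl fun d' _ => Finset.sum_congr rfl fun l _ => by ring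

lemma abs_sum_centredSum_mul_le (c : ℕ → ℝ) (s : Finset ℕ) (D : ℕ) (R : ℝ) (hR : 0 < R)
    (hc : ∀ d ∈ s, |c d| ≤ 1) (hs : ∀ d ∈ s, 1 ≤ d ∧ d ≤ D)
    (hg : ∀ d ∈ s, ∀ d' ∈ s, Nat.Coprime d d' ∨ R < Nat.gcd d d')
    (Y b q q' : ℕ) (hq : (q : ℝ) ≤ R) (hq' : (q' : ℝ) ≤ R) :
    |∑ l ∈ Finset.Icc 1 Y, centredSum c s (b + q + l) * centredSum c s (b + q' + l)|
      ≤ Y * (1 + Real.log D) ^ 3 * (if q = q' then 1 else 1 / R) + 3 * (D : ℝ) ^ 2 := by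
  set t : ℝ := if q = q' then 1 else 1 / R with ht
  have ht0 : 0 ≤ t := by rw [ht]; split_ifs <;> positivity
  have hterm : ∀ d ∈ s, ∀ d' ∈ s, |c d * c d' * dvdCorr Y d d' (b + q) (b + q')|
      ≤ Y * t * (1 / (Nat.lcm d d' : ℕ)) + 3 := by
    intro d hd d' hd'
    have h1 : |c d * c d'| ≤ 1 := by
      rw [abs_mul]
      exact mul_le_one₀ (hc d hd) (abs_nonneg _) (hc d' hd')
    rw [abs_mul]
    refine (mul_le_of_le_one_left (abs_nonneg _) h1).trans ?_
    rw [ht]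
    split_ifs with h
    · subst h
      have := abs_dvdCorr_le_lcm Y d d' (b + q) (b + q) (hs d hd).1 (hs d' hd').1
      rwa [mul_one, mul_one_div]
    · rcases hg d hd d' hd' with hcop | hgcd
      · refine (abs_dvdCorr_le_of_coprime Y d d' _ _ (hs d hd).1 (hs d' hd').1 hcop).trans ?_
        have : 0 ≤ Y * (1 / R) * (1 / ((Nat.lcm d d' : ℕ) : ℝ)) := by positivity
        linarith
      · refine (abs_dvdCorr_le_of_gcd Y d d' b q q' (hs d hd).1 (hs d' hd').1 R hR hq hq' h
          hgcd).trans (le_of_eq ?_)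
        ring
  have hcard : (s.card : ℝ) ≤ D := by
    have : s ⊆ Finset.Icc 1 D := fun d hd => Finset.mem_Icc.2 (hs d hd)
    have := Finset.card_le_card this
    rw [Nat.card_Icc, Nat.add_sub_cancel] at this
    exact_mod_cast this
  rw [sum_centredSum_mul]
  calc |∑ d ∈ s, ∑ d' ∈ s, c d * c d' * dvdCorr Y d d' (b + q) (b + q')|
      ≤ ∑ d ∈ s, ∑ d' ∈ s, |c d * c d' * dvdCorr Y d d' (b + q) (b + q')| :=
        (Finset.abs_sum_le_sum_abs _ _).trans
          (Finset.sum_le_sum fun _ _ => Finset.abs_sum_le_sum_abs _ _)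
    _ ≤ ∑ d ∈ s, ∑ d' ∈ s, (Y * t * (1 / ((Nat.lcm d d' : ℕ) : ℝ)) + 3) :=
        Finset.sum_le_sum fun d hd => Finset.sum_le_sum fun d' hd' => hterm d hd d' hd'
    _ = Y * t * (∑ d ∈ s, ∑ d' ∈ s, (1 / ((Nat.lcm d d' : ℕ) : ℝ))) + 3 * (s.card : ℝ) ^ 2 := by
        simp_rw [Finset.sum_add_distrib, ← Finset.mul_sum, Finset.sum_const, nsmul_eq_mul]
        ring
    _ ≤ Y * t * (1 + Real.log D) ^ 3 + 3 * (D : ℝ) ^ 2 := by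
        gcongr
        exact sum_inv_lcm_le D s hs
    _ = _ := by ring

lemma sum_sq_centredSum_le (c : ℕ → ℝ) (s : Finset ℕ) (D : ℕ) (R : ℝ) (hR : 0 < R)
    (hc : ∀ d ∈ s, |c d| ≤ 1) (hs : ∀ d ∈ s, 1 ≤ d ∧ d ≤ D)
    (hg : ∀ d ∈ s, ∀ d' ∈ s, Nat.Coprime d d' ∨ R < Nat.gcd d d')
    (Q : Finset ℕ) (hQR : ∀ q ∈ Q, 0 < q ∧ (q : ℝ) ≤ R) (T M b : ℕ) :
    ∑ l ∈ Finset.Icc 1 T, (∑ q ∈ Q.filter (fun q => l * q ≤ M), centredSum c s (b + l + q)) ^ 2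
      ≤ M * (1 + Real.log D) ^ 3 * (∑ q ∈ Q, (1 : ℝ) / q + (Q.card : ℝ) ^ 2 / R)
        + 3 * (D : ℝ) ^ 2 * (Q.card : ℝ) ^ 2 := by
  have hΛ : 0 ≤ (1 + Real.log D) ^ 3 := by
    have := Real.log_natCast_nonneg D
    positivity
  set Λ := (1 + Real.log D) ^ 3
  have hpair : ∀ q ∈ Q, ∀ q' ∈ Q,
      ∑ l ∈ Finset.Icc 1 T, (if l * q ≤ M then centredSum c s (b + l + q) else 0)
        * (if l * q' ≤ M then centredSum c s (b + l + q') else 0)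
      ≤ (if q = q' then M * Λ * (1 / q : ℝ) else 0) + (M * Λ / R + 3 * (D : ℝ) ^ 2) := by
    intro q hq q' hq'
    have e : ∑ l ∈ Finset.Icc 1 T, (if l * q ≤ M then centredSum c s (b + l + q) else 0)
        * (if l * q' ≤ M then centredSum c s (b + l + q') else 0)
        = ∑ l ∈ Finset.Icc 1 (min T (min (M / q) (M / q'))),
          centredSum c s (b + q + l) * centredSum c s (b + q' + l) := by
      have hset : Finset.Icc 1 (min T (min (M / q) (M / q')))
          = (Finset.Icc 1 T).filter (fun l => l * q ≤ M ∧ l * q' ≤ M) := by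
        ext l
        rw [Finset.mem_filter, Finset.mem_Icc, Finset.mem_Icc, le_min_iff, le_min_iff,
          Nat.le_div_iff_mul_le (hQR q hq).1, Nat.le_div_iff_mul_le (hQR q' hq').1]
        tauto
      rw [hset, Finset.sum_filter]
      refine Finset.sum_congr rfl fun l _ => ?_
      rw [add_right_comm b l q, add_right_comm b l q']
      by_cases h1 : l * q ≤ M <;> by_cases h2 : l * q' ≤ M <;> simp [h1, h2]
    rw [e]
    have hb := abs_sum_centredSum_mul_le c s D R hR hc hs hg (min T (min (M / q) (M / q'))) b q q'
      (hQR q hq).2 (hQR q' hq').2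
    refine (le_abs_self _).trans (hb.trans ?_)
    have hY1 : ((min T (min (M / q) (M / q')) : ℕ) : ℝ) ≤ M / q := by
      refine le_trans ?_ (Nat.cast_div_le (α := ℝ) (m := M) (n := q))
      exact_mod_cast (min_le_right _ _).trans (min_le_left _ _)
    have hY2 : ((min T (min (M / q) (M / q')) : ℕ) : ℝ) ≤ M := by
      exact_mod_cast ((min_le_right _ _).trans (min_le_left _ _)).trans (Nat.div_le_self _ _)
    set Y : ℝ := ((min T (min (M / q) (M / q')) : ℕ) : ℝ)
    split_ifs with h
    · have h1 : Y * Λ ≤ M / q * Λ := mul_le_mul_of_nonneg_right hY1 hΛ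
      have h2 : 0 ≤ M * Λ / R := by positivity
      have h3 : M / q * Λ = M * Λ * (1 / q : ℝ) := by ring
      linarith
    · have h1 : Y * Λ * (1 / R) ≤ M * Λ * (1 / R) := by gcongr
      have h3 : M * Λ * (1 / R) = M * Λ / R := by ring
      linarith
  have e0 : ∑ l ∈ Finset.Icc 1 T,
        (∑ q ∈ Q.filter (fun q => l * q ≤ M), centredSum c s (b + l + q)) ^ 2
      = ∑ q ∈ Q, ∑ q' ∈ Q, ∑ l ∈ Finset.Icc 1 T,
        (if l * q ≤ M then centredSum c s (b + l + q) else 0)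
        * (if l * q' ≤ M then centredSum c s (b + l + q') else 0) := by
    simp_rw [Finset.sum_filter, sq, Finset.sum_mul_sum]
    rw [Finset.sum_comm]
    refine Finset.sum_congr rfl fun q _ => Finset.sum_comm
  rw [e0]
  refine (Finset.sum_le_sum fun q hq => Finset.sum_le_sum fun q' hq' =>
    hpair q hq q' hq').trans (le_of_eq ?_)
  simp_rw [Finset.sum_add_distrib, Finset.sum_ite_eq]
  rw [Finset.sum_congr rfl (fun q hq => if_pos hq), ← Finset.mul_sum]
  simp only [Finset.sum_const, nsmul_eq_mul]
  ring

lemma sum_abs_centredSum_le (c : ℕ → ℝ) (s : Finset ℕ) (D : ℕ) (R y q₀ q₁ : ℝ)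
    (hc : ∀ d ∈ s, |c d| ≤ 1) (hs : ∀ d ∈ s, 1 ≤ d ∧ d ≤ D)
    (hg : ∀ d ∈ s, ∀ d' ∈ s, Nat.Coprime d d' ∨ R < Nat.gcd d d')
    (P Q : Finset ℕ) (hP : ∀ p ∈ P, y ≤ p) (hP0 : ∀ p ∈ P, 0 < p)
    (hQ : ∀ q ∈ Q, q₀ ≤ q ∧ (q : ℝ) ≤ q₁)
    (hQcard : (Q.card : ℝ) ≤ q₁) (hq₀ : 1 ≤ q₀) (hq₁ : 1 ≤ q₁) (hR : q₁ ^ 2 ≤ R)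
    (hy : 3 * (D : ℝ) ^ 2 * q₁ ^ 2 ≤ y) (M b : ℕ) :
    ∑ l ∈ P, |∑ q ∈ Q.filter (fun q => l * q ≤ M), centredSum c s (b + l + q)|
      ≤ M * √(((1 + Real.log D) ^ 3 * (∑ q ∈ Q, (1 : ℝ) / q + 1) + 1) / q₀) := by
  have hR0 : 0 < R := by nlinarith
  have hQR : ∀ q ∈ Q, 0 < q ∧ (q : ℝ) ≤ R := by
    intro q hq
    have h1 := hQ q hq
    refine ⟨?_, by nlinarith⟩
    have : (0 : ℝ) < q := by linarith
    exact_mod_cast this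
  have hΛ : 0 ≤ (1 + Real.log D) ^ 3 := by
    have := Real.log_natCast_nonneg D
    positivity
  have hL : 0 ≤ ∑ q ∈ Q, (1 : ℝ) / q := Finset.sum_nonneg fun _ _ => by positivity
  set T := ⌊(M : ℝ) / q₀⌋₊ with hT
  have hT' : (T : ℝ) ≤ M / q₀ := Nat.floor_le (by positivity)
  have hzero : ∀ l ∈ P, ¬ l ≤ T →
      |∑ q ∈ Q.filter (fun q => l * q ≤ M), centredSum c s (b + l + q)| = 0 := by
    intro l hl hlT
    rw [abs_eq_zero]
    apply Finset.sum_eq_zero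
    intro q hq
    exfalso
    apply hlT
    rw [Finset.mem_filter] at hq
    apply Nat.le_floor
    rw [le_div_iff₀ (by linarith)]
    have h1 := (hQ q hq.1).1
    have h2 : (l : ℝ) * q ≤ M := by exact_mod_cast hq.2
    exact (mul_le_mul_of_nonneg_left h1 (Nat.cast_nonneg l)).trans h2
  have hle : ∑ l ∈ P, |∑ q ∈ Q.filter (fun q => l * q ≤ M), centredSum c s (b + l + q)|
      ≤ ∑ l ∈ Finset.Icc 1 T,
        |∑ q ∈ Q.filter (fun q => l * q ≤ M), centredSum c s (b + l + q)| := by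
    rw [← Finset.sum_filter_add_sum_filter_not P (· ≤ T)]
    rw [Finset.sum_eq_zero (s := P.filter (¬ · ≤ T)) (fun l hl => by
      rw [Finset.mem_filter] at hl
      exact hzero l hl.1 hl.2), add_zero]
    apply Finset.sum_le_sum_of_subset_of_nonneg
    · intro l hl
      rw [Finset.mem_filter] at hl
      exact Finset.mem_Icc.2 ⟨hP0 l hl.1, hl.2⟩
    · intro _ _ _; exact abs_nonneg _
  by_cases hex : ∃ l ∈ P, l ≤ T
  · obtain ⟨l, hl, hlT⟩ := hex
    have hyM : y ≤ M := by
      have h1 : (l : ℝ) ≤ T := by exact_mod_cast hlT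
      have h2 : (M : ℝ) / q₀ ≤ M := div_le_self (Nat.cast_nonneg _) hq₀
      linarith [hP l hl]
    refine hle.trans ?_
    have h2 := sum_sq_centredSum_le c s D R hR0 hc hs hg Q hQR T M b
    set Λ := (1 + Real.log D) ^ 3
    set L := ∑ q ∈ Q, (1 : ℝ) / q
    have hc2 : (Q.card : ℝ) ^ 2 ≤ q₁ ^ 2 := pow_le_pow_left₀ (Nat.cast_nonneg _) hQcard 2
    have h3 : M * Λ * (L + (Q.card : ℝ) ^ 2 / R) + 3 * (D : ℝ) ^ 2 * (Q.card : ℝ) ^ 2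
        ≤ M * (Λ * (L + 1) + 1) := by
      have h4 : (Q.card : ℝ) ^ 2 / R ≤ 1 := by
        rw [div_le_one hR0]; exact hc2.trans hR
      have h5 : 3 * (D : ℝ) ^ 2 * (Q.card : ℝ) ^ 2 ≤ M :=
        (mul_le_mul_of_nonneg_left hc2 (by positivity)).trans (hy.trans hyM)
      have h6 : M * Λ * (L + (Q.card : ℝ) ^ 2 / R) ≤ M * Λ * (L + 1) :=
        mul_le_mul_of_nonneg_left (by linarith) (by positivity)
      nlinarith
    apply le_of_sq_le_sq _ (by positivity)
    have hcs := sq_sum_le_card_mul_sum_sq (s := Finset.Icc 1 T)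
      (f := fun l => |∑ q ∈ Q.filter (fun q => l * q ≤ M), centredSum c s (b + l + q)|)
    refine hcs.trans ?_
    simp only [sq_abs, Nat.card_Icc, Nat.add_sub_cancel]
    rw [mul_pow, Real.sq_sqrt (by positivity)]
    calc (T : ℝ) * _ ≤ (M / q₀) * (M * (Λ * (L + 1) + 1)) :=
          mul_le_mul hT' (h2.trans h3) (Finset.sum_nonneg fun _ _ => sq_nonneg _) (by positivity)
      _ = _ := by ring
  · push Not at hex
    rw [Finset.sum_eq_zero fun l hl => hzero l hl (not_le.2 (hex l hl))]
    positivity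

/-- The variance bound: averages of `centredSum c s (a m + p + q)` over `p * q * m ≤ N`. -/
lemma abs_sum_bilinear_centredSum_le (c : ℕ → ℝ) (s : Finset ℕ) (D : ℕ) (R y q₀ q₁ : ℝ)
    (hc : ∀ d ∈ s, |c d| ≤ 1) (hs : ∀ d ∈ s, 1 ≤ d ∧ d ≤ D)
    (hg : ∀ d ∈ s, ∀ d' ∈ s, Nat.Coprime d d' ∨ R < Nat.gcd d d')
    (P Q : Finset ℕ) (hP : ∀ p ∈ P, y ≤ p) (hP0 : ∀ p ∈ P, 0 < p)
    (hQ : ∀ q ∈ Q, q₀ ≤ q ∧ (q : ℝ) ≤ q₁)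
    (hQcard : (Q.card : ℝ) ≤ q₁) (hq₀ : 1 ≤ q₀) (hq₁ : 1 ≤ q₁) (hR : q₁ ^ 2 ≤ R)
    (hy : 3 * (D : ℝ) ^ 2 * q₁ ^ 2 ≤ y) (N : ℕ) (a : ℕ → ℕ) :
    |∑ p ∈ P, ∑ q ∈ Q, ∑ m ∈ Finset.Icc 1 (N / p / q), centredSum c s (a m + p + q)|
      ≤ N * (1 + Real.log N) *
        √(((1 + Real.log D) ^ 3 * (∑ q ∈ Q, (1 : ℝ) / q + 1) + 1) / q₀) := by
  have hq0 : ∀ q ∈ Q, 0 < q := fun q hq => by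
    have : (0 : ℝ) < q := by linarith [(hQ q hq).1]
    exact_mod_cast this
  have e : ∑ p ∈ P, ∑ q ∈ Q, ∑ m ∈ Finset.Icc 1 (N / p / q), centredSum c s (a m + p + q)
      = ∑ m ∈ Finset.Icc 1 N, ∑ p ∈ P, ∑ q ∈ Q.filter (fun q => p * q ≤ N / m),
          centredSum c s (a m + p + q) := by
    have h1 : ∀ p ∈ P, ∀ q ∈ Q, ∑ m ∈ Finset.Icc 1 (N / p / q), centredSum c s (a m + p + q)
        = ∑ m ∈ Finset.Icc 1 N, if p * q ≤ N / m then centredSum c s (a m + p + q) else 0 := by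
      intro p hp q hq
      rw [← Finset.sum_filter]
      refine Finset.sum_congr ?_ fun _ _ => rfl
      ext m
      have hpq : 0 < p * q := Nat.mul_pos (hP0 p hp) (hq0 q hq)
      rw [Finset.mem_filter, Finset.mem_Icc, Finset.mem_Icc, Nat.div_div_eq_div_mul,
        Nat.le_div_iff_mul_le hpq]
      constructor
      · rintro ⟨h1, h2⟩
        refine ⟨⟨h1, (Nat.le_mul_of_pos_right m hpq).trans h2⟩, ?_⟩
        rw [Nat.le_div_iff_mul_le h1, mul_comm]
        exact h2
      · rintro ⟨⟨h1, _⟩, h2⟩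
        rw [Nat.le_div_iff_mul_le h1, mul_comm] at h2
        exact ⟨h1, h2⟩
    rw [Finset.sum_congr rfl fun p hp => Finset.sum_congr rfl fun q hq => h1 p hp q hq]
    simp_rw [Finset.sum_filter]
    rw [Finset.sum_comm (s := Finset.Icc 1 N)]
    exact Finset.sum_congr rfl fun p _ => Finset.sum_comm
  rw [e]
  set W := √(((1 + Real.log D) ^ 3 * (∑ q ∈ Q, (1 : ℝ) / q + 1) + 1) / q₀)
  have hH : ∑ n ∈ Finset.Icc 1 N, (1 : ℝ) / n ≤ 1 + Real.log N := by
    have := harmonic_le_one_add_log N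
    rw [harmonic_eq_sum_Icc] at this
    push_cast at this
    simpa using this
  calc _ ≤ ∑ m ∈ Finset.Icc 1 N, ∑ p ∈ P, |∑ q ∈ Q.filter (fun q => p * q ≤ N / m),
          centredSum c s (a m + p + q)| :=
        (Finset.abs_sum_le_sum_abs _ _).trans
          (Finset.sum_le_sum fun _ _ => Finset.abs_sum_le_sum_abs _ _)
    _ ≤ ∑ m ∈ Finset.Icc 1 N, N * (1 / m : ℝ) * W := by
        refine Finset.sum_le_sum fun m _ => ?_
        refine (sum_abs_centredSum_le c s D R y q₀ q₁ hc hs hg P Q hP hP0 hQ hQcard hq₀ hq₁ hR hy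
          (N / m) (a m)).trans ?_
        rw [mul_one_div]
        exact mul_le_mul_of_nonneg_right Nat.cast_div_le (Real.sqrt_nonneg _)
    _ = N * (∑ m ∈ Finset.Icc 1 N, (1 / m : ℝ)) * W := by
        rw [Finset.mul_sum, Finset.sum_mul]
    _ ≤ _ := by gcongr

/-- The sum of the prime divisors of `n`, counted with multiplicity. -/
def sopfr (n : ℕ) : ℕ := ∑ p ∈ n.primeFactors, n.factorization p * p

lemma sopfr_eq_sum (n : ℕ) : sopfr n = n.factorization.sum fun p k => k * p := by
  simp [sopfr, Finsupp.sum]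

lemma sopfr_mul {a b : ℕ} (ha : a ≠ 0) (hb : b ≠ 0) : sopfr (a * b) = sopfr a + sopfr b := by
  rw [sopfr_eq_sum, sopfr_eq_sum, sopfr_eq_sum, Nat.factorization_mul ha hb,
    Finsupp.sum_add_index' (by simp) (by intros; ring)]

lemma sopfr_prime {p : ℕ} (hp : p.Prime) : sopfr p = p := by
  simp [sopfr_eq_sum, hp.factorization]

lemma sopfr_prime_mul {p m : ℕ} (hp : p.Prime) (hm : m ≠ 0) :
    sopfr (p * m) = sopfr m + p := by
  rw [sopfr_mul hp.ne_zero hm, sopfr_prime hp, add_comm]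

lemma sopfr_le {n : ℕ} (hn : n ≠ 0) : sopfr n ≤ n := by
  induction n using Nat.recOnMul with
  | zero => exact absurd rfl hn
  | one => simp [sopfr]
  | prime p hp => rw [sopfr_prime hp]
  | mul a b iha ihb =>
    have ha : a ≠ 0 := left_ne_zero_of_mul hn
    have hb : b ≠ 0 := right_ne_zero_of_mul hn
    rw [sopfr_mul ha hb]
    rcases eq_or_ne a 1 with rfl | ha1
    · simpa [sopfr] using ihb hb
    rcases eq_or_ne b 1 with rfl | hb1
    · simpa [sopfr] using iha ha
    have h1 := iha ha
    have h2 := ihb hb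
    have : 2 ≤ a := by omega
    have : 2 ≤ b := by omega
    nlinarith

lemma sopfr_ne_zero {n : ℕ} (hn : 2 ≤ n) : sopfr n ≠ 0 := by
  obtain ⟨p, hp, hpn⟩ := Nat.exists_prime_and_dvd (by omega : n ≠ 1)
  obtain ⟨m, rfl⟩ := hpn
  have hm : m ≠ 0 := by rintro rfl; omega
  rw [sopfr_prime_mul hp hm]
  have := hp.pos
  omega

/-- Error in truncating the binomial expansion of `(1 + y) ^ n` when `‖1 + y‖ ≤ 1`. -/
lemma norm_one_add_pow_sub_le {y : ℂ} (hy : ‖1 + y‖ ≤ 1) (n K : ℕ) :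
    ‖(1 + y) ^ n - ∑ k ∈ Finset.range K, (n.choose k : ℂ) * y ^ k‖
      ≤ ‖y‖ ^ K * (n.choose K : ℝ) := by
  induction n generalizing K with
  | zero =>
    rcases K with _ | K
    · simp
    · rw [Finset.sum_range_succ', Finset.sum_eq_zero]
      · simp
      · intro k _; simp
  | succ n ih =>
    rcases K with _ | K
    · simp only [Finset.range_zero, Finset.sum_empty, sub_zero, norm_pow, pow_zero, one_mul,
        Nat.choose_zero_right, Nat.cast_one]
      exact pow_le_one₀ (norm_nonneg _) hy
    · have e : (1 + y) ^ (n + 1) - ∑ k ∈ Finset.range (K + 1), ((n + 1).choose k : ℂ) * y ^ k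
          = (1 + y) * ((1 + y) ^ n - ∑ k ∈ Finset.range (K + 1), (n.choose k : ℂ) * y ^ k)
            + y ^ (K + 1) * n.choose K := by
        rw [Finset.sum_range_succ', Finset.sum_range_succ' (n := K)]
        simp only [Nat.choose_succ_succ', Nat.cast_add, add_mul, Finset.sum_add_distrib,
          Nat.choose_zero_right, pow_zero]
        have e1 : ∑ k ∈ Finset.range K, (n.choose k : ℂ) * y ^ (k + 1)
            = y * ∑ k ∈ Finset.range K, (n.choose k : ℂ) * y ^ k := by
          rw [Finset.mul_sum]
          exact Finset.sum_congr rfl fun k _ => by ring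
        have e2 : y * ∑ k ∈ Finset.range (K + 1), (n.choose k : ℂ) * y ^ k
            = y * ∑ k ∈ Finset.range K, (n.choose k : ℂ) * y ^ k + y ^ (K + 1) * n.choose K := by
          rw [Finset.sum_range_succ]; ring
        have e3 : ∑ k ∈ Finset.range (K + 1), (n.choose k : ℂ) * y ^ k
            = ∑ k ∈ Finset.range K, (n.choose (k + 1) : ℂ) * y ^ (k + 1) + 1 := by
          rw [Finset.sum_range_succ']; simp
        rw [e1]
        rw [e3] at e2
        linear_combination e2
      rw [e]
      refine (norm_add_le _ _).trans ?_
      rw [norm_mul, norm_mul, norm_pow, Nat.choose_succ_succ']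
      have h1 := ih (K + 1)
      have h2 : ‖1 + y‖ * ‖(1 + y) ^ n - ∑ k ∈ Finset.range (K + 1), (n.choose k : ℂ) * y ^ k‖
          ≤ ‖y‖ ^ (K + 1) * (n.choose (K + 1) : ℝ) :=
        (mul_le_of_le_one_left (norm_nonneg _) hy).trans h1
      rw [Complex.norm_natCast]
      push_cast
      linarith

lemma primes_prod_dvd_iff {U : Finset ℕ} (hU : ∀ p ∈ U, p.Prime) (a : ℕ) :
    ∏ p ∈ U, p ∣ a ↔ ∀ p ∈ U, p ∣ a :=
  ⟨fun h _ hp => (Finset.dvd_prod_of_mem _ hp).trans h,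
    fun h => Finset.prod_primes_dvd a (fun p hp => (hU p hp).prime) h⟩

lemma sum_powersetCard_dvdInd {S : Finset ℕ} (hS : ∀ p ∈ S, p.Prime) (k a : ℕ) :
    ∑ U ∈ S.powersetCard k, dvdInd (∏ p ∈ U, p) a = ((divCount S a).choose k : ℝ) := by
  unfold dvdInd divCount
  rw [← Finset.card_powersetCard, Finset.sum_boole]
  congr 2
  ext U
  rw [Finset.mem_filter, Finset.mem_powersetCard, Finset.mem_powersetCard]
  constructor
  · rintro ⟨⟨h1, h2⟩, h3⟩
    refine ⟨fun p hp => Finset.mem_filter.2 ⟨h1 hp, ?_⟩, h2⟩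
    exact (Finset.dvd_prod_of_mem _ hp).trans h3
  · rintro ⟨h1, h2⟩
    refine ⟨⟨fun p hp => (Finset.mem_filter.1 (h1 hp)).1, h2⟩, ?_⟩
    rw [primes_prod_dvd_iff fun p hp => hS p (Finset.mem_filter.1 (h1 hp)).1]
    exact fun p hp => (Finset.mem_filter.1 (h1 hp)).2

lemma injOn_prod_primes {S : Finset ℕ} (hS : ∀ p ∈ S, p.Prime) :
    Set.InjOn (fun U : Finset ℕ => ∏ p ∈ U, p) (S.powerset : Set (Finset ℕ)) := by
  intro U hU V hV h
  have hU' := Finset.mem_powerset.1 (Finset.mem_coe.1 hU)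
  have hV' := Finset.mem_powerset.1 (Finset.mem_coe.1 hV)
  rw [← Nat.primeFactors_prod fun p hp => hS p (hU' hp),
    ← Nat.primeFactors_prod fun p hp => hS p (hV' hp)]
  exact congrArg Nat.primeFactors h

lemma coprime_or_lt_gcd_prod {S : Finset ℕ} (hS : ∀ p ∈ S, p.Prime) {R : ℝ}
    (hR : ∀ p ∈ S, R < p) {U V : Finset ℕ} (hU : U ⊆ S) :
    Nat.Coprime (∏ p ∈ U, p) (∏ p ∈ V, p) ∨ R < Nat.gcd (∏ p ∈ U, p) (∏ p ∈ V, p) := by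
  by_cases h : Nat.Coprime (∏ p ∈ U, p) (∏ p ∈ V, p)
  · exact Or.inl h
  · right
    obtain ⟨r, hr, hrg⟩ := Nat.exists_prime_and_dvd h
    have hrU := hrg.trans (Nat.gcd_dvd_left _ _)
    obtain ⟨p, hp, hrp⟩ := (hr.prime.dvd_finsetProd_iff _).1 hrU
    have := (Nat.prime_dvd_prime_iff_eq hr (hS p (hU hp))).1 hrp
    subst this
    have hpos : 0 < Nat.gcd (∏ p ∈ U, p) (∏ p ∈ V, p) :=
      Nat.gcd_pos_of_pos_left _ (Finset.prod_pos fun p hp => (hS p (hU hp)).pos)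
    calc R < r := hR r (hU hp)
      _ ≤ _ := by exact_mod_cast Nat.le_of_dvd hpos hrg

/-- The part of `∏ (1 + x / p)` with at least `K` factors. -/
noncomputable def productTail (S : Finset ℕ) (K : ℕ) (x : ℝ) : ℝ :=
  ∑ U ∈ S.powerset.filter (fun U => K ≤ U.card), x ^ U.card / ((∏ p ∈ U, p : ℕ) : ℝ)

lemma productTail_nonneg (S : Finset ℕ) (K : ℕ) {x : ℝ} (hx : 0 ≤ x) : 0 ≤ productTail S K x :=
  Finset.sum_nonneg fun _ _ => by positivity

lemma pow_card_div_prod {F : Type*} [Field F] (U : Finset ℕ) (x : F) :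
    ∏ p ∈ U, (x / (p : F)) = x ^ U.card / ((∏ p ∈ U, p : ℕ) : F) := by
  rw [Finset.prod_div_distrib, Finset.prod_const, Nat.cast_prod]

lemma prod_one_add_div_eq {F : Type*} [Field F] (S : Finset ℕ) (x : F) :
    ∏ p ∈ S, (1 + x / (p : F)) = ∑ U ∈ S.powerset, x ^ U.card / ((∏ p ∈ U, p : ℕ) : F) := by
  rw [Finset.prod_one_add]
  exact Finset.sum_congr rfl fun U _ => pow_card_div_prod U x

lemma productTail_le (S : Finset ℕ) (K : ℕ) {x : ℝ} (hx : 0 ≤ x) :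
    productTail S K x ≤ Real.exp (Real.exp 1 * x * ∑ p ∈ S, (1 : ℝ) / p - K) := by
  have h1 : productTail S K x ≤ Real.exp (-K) *
      ∑ U ∈ S.powerset, (Real.exp 1 * x) ^ U.card / ((∏ p ∈ U, p : ℕ) : ℝ) := by
    unfold productTail
    rw [Finset.mul_sum]
    refine (Finset.sum_le_sum fun U hU => ?_).trans
      (Finset.sum_le_sum_of_subset_of_nonneg (Finset.filter_subset _ _)
        fun U _ _ => by positivity)
    have hK : (K : ℝ) ≤ U.card := by exact_mod_cast (Finset.mem_filter.1 hU).2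
    rw [mul_pow, mul_div_assoc, ← mul_assoc, ← Real.exp_nat_mul, ← Real.exp_add]
    refine le_mul_of_one_le_left (by positivity) (Real.one_le_exp ?_)
    linarith
  refine h1.trans ?_
  rw [← prod_one_add_div_eq, sub_eq_neg_add, Real.exp_add, Finset.mul_sum, Real.exp_sum]
  gcongr with p hp
  rw [mul_one_div, add_comm]
  exact Real.add_one_le_exp _

/-- Products of at most `K - 1` (or exactly `K`) elements of `S`, weighted by powers of `y`. -/
noncomputable def centredFamily (𝒰 : Finset (Finset ℕ)) (y : ℂ) (a : ℕ) : ℂ :=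
  ∑ U ∈ 𝒰, y ^ U.card * ((dvdInd (∏ p ∈ U, p) a : ℂ) - 1 / ((∏ p ∈ U, p : ℕ) : ℂ))

lemma re_centredFamily {S : Finset ℕ} (hS : ∀ p ∈ S, p.Prime) {𝒰 : Finset (Finset ℕ)}
    (h𝒰 : 𝒰 ⊆ S.powerset) (y : ℂ) (a : ℕ) :
    (centredFamily 𝒰 y a).re = centredSum (fun d => (y ^ d.primeFactors.card).re)
      (𝒰.image fun U => ∏ p ∈ U, p) a := by
  unfold centredFamily centredSum
  rw [Finset.sum_image ((injOn_prod_primes hS).mono (by exact_mod_cast h𝒰)), Complex.re_sum]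
  refine Finset.sum_congr rfl fun U hU => ?_
  beta_reduce
  rw [Nat.primeFactors_prod fun p hp => hS p (Finset.mem_powerset.1 (h𝒰 hU) hp)]
  have : (dvdInd (∏ p ∈ U, p) a : ℂ) - 1 / ((∏ p ∈ U, p : ℕ) : ℂ)
      = ((dvdInd (∏ p ∈ U, p) a - 1 / ((∏ p ∈ U, p : ℕ) : ℝ) : ℝ) : ℂ) := by push_cast; rfl
  rw [this, Complex.re_mul_ofReal]

lemma im_centredFamily {S : Finset ℕ} (hS : ∀ p ∈ S, p.Prime) {𝒰 : Finset (Finset ℕ)}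
    (h𝒰 : 𝒰 ⊆ S.powerset) (y : ℂ) (a : ℕ) :
    (centredFamily 𝒰 y a).im = centredSum (fun d => (y ^ d.primeFactors.card).im)
      (𝒰.image fun U => ∏ p ∈ U, p) a := by
  unfold centredFamily centredSum
  rw [Finset.sum_image ((injOn_prod_primes hS).mono (by exact_mod_cast h𝒰)), Complex.im_sum]
  refine Finset.sum_congr rfl fun U hU => ?_
  beta_reduce
  rw [Nat.primeFactors_prod fun p hp => hS p (Finset.mem_powerset.1 (h𝒰 hU) hp)]
  have : (dvdInd (∏ p ∈ U, p) a : ℂ) - 1 / ((∏ p ∈ U, p : ℕ) : ℂ)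
      = ((dvdInd (∏ p ∈ U, p) a - 1 / ((∏ p ∈ U, p : ℕ) : ℝ) : ℝ) : ℂ) := by push_cast; rfl
  rw [this, Complex.im_mul_ofReal]

lemma norm_one_add_div_le {y : ℂ} (hy : ‖1 + y‖ ≤ 1) {p : ℕ} (hp : 1 ≤ p) :
    ‖1 + y / p‖ ≤ 1 := by
  have hp0 : (0 : ℝ) < p := by exact_mod_cast hp
  have hpC : (p : ℂ) ≠ 0 := by exact_mod_cast hp0.ne'
  have e : 1 + y / p = ((1 - 1 / p : ℝ) : ℂ) + (1 + y) / p := by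
    push_cast; field_simp; ring
  have h1 : (1 : ℝ) / p ≤ 1 := by
    rw [div_le_one hp0]; exact_mod_cast hp
  rw [e]
  refine (norm_add_le _ _).trans ?_
  rw [Complex.norm_of_nonneg (by linarith), norm_div, Complex.norm_natCast]
  have : ‖1 + y‖ / p ≤ 1 / p := by gcongr
  linarith

lemma norm_prod_one_add_div_le {S : Finset ℕ} (hS : ∀ p ∈ S, p.Prime) {y : ℂ}
    (hy : ‖1 + y‖ ≤ 1) : ‖∏ p ∈ S, (1 + y / p)‖ ≤ 1 := by
  rw [norm_prod]
  exact Finset.prod_le_one (fun _ _ => norm_nonneg _)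
    fun p hp => norm_one_add_div_le hy (hS p hp).one_lt.le

/-- Pointwise decomposition of `(1 + y) ^ Ω_S(a)` into its mean and centred divisor sums. -/
lemma norm_pow_divCount_sub_le {S : Finset ℕ} (hS : ∀ p ∈ S, p.Prime) {y : ℂ}
    (hy1 : ‖1 + y‖ ≤ 1) (K a : ℕ) :
    ‖(1 + y) ^ divCount S a - ∏ p ∈ S, (1 + y / p)
        - centredFamily (S.powerset.filter fun U => U.card < K) y a‖
      ≤ 2 * productTail S K ‖y‖ + ‖y‖ ^ K * (centredFamily (S.powersetCard K) 1 a).re := by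
  set M : ℂ := ∑ U ∈ S.powerset.filter (fun U => U.card < K), y ^ U.card / ((∏ p ∈ U, p : ℕ) : ℂ)
  have hchoose : ∀ k, ∑ U ∈ S.powersetCard k, (dvdInd (∏ p ∈ U, p) a : ℂ)
      = ((divCount S a).choose k : ℂ) := by
    intro k
    have := sum_powersetCard_dvdInd hS k a
    exact_mod_cast congrArg ((↑) : ℝ → ℂ) this
  have h1 : ∑ k ∈ Finset.range K, ((divCount S a).choose k : ℂ) * y ^ k
      = M + centredFamily (S.powerset.filter fun U => U.card < K) y a := by
    have e1 : M + centredFamily (S.powerset.filter fun U => U.card < K) y a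
        = ∑ U ∈ S.powerset.filter (fun U => U.card < K),
          y ^ U.card * (dvdInd (∏ p ∈ U, p) a : ℂ) := by
      unfold centredFamily
      rw [← Finset.sum_add_distrib]
      exact Finset.sum_congr rfl fun U _ => by ring
    rw [e1, ← Finset.sum_fiberwise_of_maps_to (t := Finset.range K) (g := Finset.card)
      (fun U hU => Finset.mem_range.2 (Finset.mem_filter.1 hU).2)]
    refine Finset.sum_congr rfl fun k hk => ?_
    have e2 : (S.powerset.filter fun U => U.card < K).filter (fun U => U.card = k)
        = S.powersetCard k := by
      ext U
      have := Finset.mem_range.1 hk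
      simp only [Finset.mem_filter, Finset.mem_powerset, Finset.mem_powersetCard]
      constructor
      · rintro ⟨⟨h1, _⟩, h2⟩; exact ⟨h1, h2⟩
      · rintro ⟨h1, h2⟩; exact ⟨⟨h1, by omega⟩, h2⟩
    rw [e2, ← hchoose, Finset.sum_mul]
    refine Finset.sum_congr rfl fun U hU => ?_
    rw [(Finset.mem_powersetCard.1 hU).2, mul_comm]
  have h2 : ‖∏ p ∈ S, (1 + y / p) - M‖ ≤ productTail S K ‖y‖ := by
    rw [prod_one_add_div_eq, ← Finset.sum_filter_add_sum_filter_not _ (fun U => U.card < K),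
      add_sub_cancel_left]
    refine (norm_sum_le _ _).trans (le_of_eq ?_)
    unfold productTail
    refine Finset.sum_congr (by simp only [not_lt]) fun U _ => ?_
    rw [norm_div, norm_pow, Complex.norm_natCast]
  have h3 := norm_one_add_pow_sub_le hy1 (divCount S a) K
  have h4 : ‖y‖ ^ K * ((divCount S a).choose K : ℝ)
      ≤ productTail S K ‖y‖ + ‖y‖ ^ K * (centredFamily (S.powersetCard K) 1 a).re := by
    have e : ((divCount S a).choose K : ℝ)
        = ∑ U ∈ S.powersetCard K, 1 / ((∏ p ∈ U, p : ℕ) : ℝ)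
          + (centredFamily (S.powersetCard K) 1 a).re := by
      unfold centredFamily
      rw [← sum_powersetCard_dvdInd hS K a, Complex.re_sum, ← Finset.sum_add_distrib]
      refine Finset.sum_congr rfl fun U _ => ?_
      have : (dvdInd (∏ p ∈ U, p) a : ℂ) - 1 / ((∏ p ∈ U, p : ℕ) : ℂ)
        = ((dvdInd (∏ p ∈ U, p) a - 1 / ((∏ p ∈ U, p : ℕ) : ℝ) : ℝ) : ℂ) := by push_cast; rfl
      rw [one_pow, one_mul, this, Complex.ofReal_re]
      ring
    rw [e, mul_add, Finset.mul_sum]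
    gcongr
    unfold productTail
    refine (le_of_eq (Finset.sum_congr rfl fun U hU => ?_)).trans
      (Finset.sum_le_sum_of_subset_of_nonneg (s := S.powersetCard K)
        (f := fun U => ‖y‖ ^ U.card / ((∏ p ∈ U, p : ℕ) : ℝ)) (fun U hU => ?_)
        fun U _ _ => by positivity)
    · rw [(Finset.mem_powersetCard.1 hU).2]; ring
    · have := Finset.mem_powersetCard.1 hU
      exact Finset.mem_filter.2 ⟨Finset.mem_powerset.2 this.1, this.2.ge⟩
  rw [h1] at h3
  have e : (1 + y) ^ divCount S a - ∏ p ∈ S, (1 + y / p)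
        - centredFamily (S.powerset.filter fun U => U.card < K) y a
      = ((1 + y) ^ divCount S a
          - (M + centredFamily (S.powerset.filter fun U => U.card < K) y a))
        - (∏ p ∈ S, (1 + y / p) - M) := by ring
  rw [e]
  refine (norm_sub_le _ _).trans ?_
  linarith

/-- The constraints on the two families of primes used for averaging. -/
structure AveragingData (R : ℝ) (D : ℕ) (y q₀ q₁ : ℝ) (P Q : Finset ℕ) : Prop where
  le_left : ∀ p ∈ P, y ≤ p
  prime_left : ∀ p ∈ P, p.Prime
  prime_right : ∀ q ∈ Q, q.Prime
  mem_right : ∀ q ∈ Q, q₀ ≤ q ∧ (q : ℝ) ≤ q₁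
  card_right : (Q.card : ℝ) ≤ q₁
  one_le : 1 ≤ q₀
  one_le' : 1 ≤ q₁
  sq_le : q₁ ^ 2 ≤ R
  le_y : 3 * (D : ℝ) ^ 2 * q₁ ^ 2 ≤ y

/-- The bound provided by `abs_sum_bilinear_centredSum_le`. -/
noncomputable def averagingBound (N D : ℕ) (q₀ : ℝ) (Q : Finset ℕ) : ℝ :=
  N * (1 + Real.log N) * √(((1 + Real.log D) ^ 3 * (∑ q ∈ Q, (1 : ℝ) / q + 1) + 1) / q₀)

lemma AveragingData.abs_sum_le {R : ℝ} {D : ℕ} {y q₀ q₁ : ℝ} {P Q : Finset ℕ}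
    (h : AveragingData R D y q₀ q₁ P Q) (c : ℕ → ℝ) (s : Finset ℕ)
    (hc : ∀ d ∈ s, |c d| ≤ 1) (hs : ∀ d ∈ s, 1 ≤ d ∧ d ≤ D)
    (hg : ∀ d ∈ s, ∀ d' ∈ s, Nat.Coprime d d' ∨ R < Nat.gcd d d') (N : ℕ) (a : ℕ → ℕ) :
    |∑ p ∈ P, ∑ q ∈ Q, ∑ m ∈ Finset.Icc 1 (N / p / q), centredSum c s (a m + p + q)|
      ≤ averagingBound N D q₀ Q :=
  abs_sum_bilinear_centredSum_le c s D R y q₀ q₁ hc hs hg P Q h.le_left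
    (fun p hp => (h.prime_left p hp).pos) h.mem_right h.card_right h.one_le h.one_le' h.sq_le
    h.le_y N a

lemma AveragingData.norm_sum_pow_divCount_le {R : ℝ} {D : ℕ} {w q₀ q₁ : ℝ} {P Q : Finset ℕ}
    (h : AveragingData R D w q₀ q₁ P Q) {S : Finset ℕ} (hS : ∀ p ∈ S, p.Prime)
    (hR : ∀ p ∈ S, R < p) {K : ℕ} (hD : ∀ U ⊆ S, U.card ≤ K → ∏ p ∈ U, p ≤ D)
    {y : ℂ} (hy1 : ‖1 + y‖ ≤ 1) (hy : ‖y‖ ≤ 1) (N : ℕ) (a : ℕ → ℕ) :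
    ‖∑ p ∈ P, ∑ q ∈ Q, ∑ m ∈ Finset.Icc 1 (N / p / q),
        ((1 + y) ^ divCount S (a m + p + q) - ∏ r ∈ S, (1 + y / r))‖
      ≤ 2 * productTail S K ‖y‖ * (∑ p ∈ P, ∑ q ∈ Q, ((N / p / q : ℕ) : ℝ))
        + 3 * averagingBound N D q₀ Q := by
  set 𝒰 := S.powerset.filter fun U => U.card < K with h𝒰
  have h𝒰S : 𝒰 ⊆ S.powerset := Finset.filter_subset _ _
  have h𝒱S : S.powersetCard K ⊆ S.powerset := fun U hU =>
    Finset.mem_powerset.2 (Finset.mem_powersetCard.1 hU).1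
  have hone : ∀ U ⊆ S, 1 ≤ ∏ p ∈ U, p := fun U hU =>
    Finset.prod_pos fun p hp => (hS p (hU hp)).pos
  have key : ∀ (𝒲 : Finset (Finset ℕ)), 𝒲 ⊆ S.powerset → (∀ U ∈ 𝒲, U.card ≤ K) →
      ∀ c : ℕ → ℝ, (∀ d, |c d| ≤ 1) →
      |∑ p ∈ P, ∑ q ∈ Q, ∑ m ∈ Finset.Icc 1 (N / p / q),
        centredSum c (𝒲.image fun U => ∏ p ∈ U, p) (a m + p + q)| ≤ averagingBound N D q₀ Q := by
    intro 𝒲 hW hWK c hc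
    refine h.abs_sum_le c _ (fun d _ => hc d) ?_ ?_ N a
    · intro d hd
      obtain ⟨U, hU, rfl⟩ := Finset.mem_image.1 hd
      have hUS := Finset.mem_powerset.1 (hW hU)
      exact ⟨hone U hUS, hD U hUS (hWK U hU)⟩
    · intro d hd d' hd'
      obtain ⟨U, hU, rfl⟩ := Finset.mem_image.1 hd
      obtain ⟨V, hV, rfl⟩ := Finset.mem_image.1 hd'
      exact coprime_or_lt_gcd_prod hS hR (Finset.mem_powerset.1 (hW hU))
  have hpow : ∀ (z : ℂ), ‖z‖ ≤ 1 → ∀ k : ℕ, ‖z ^ k‖ ≤ 1 := fun z hz k => by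
    rw [norm_pow]; exact pow_le_one₀ (norm_nonneg _) hz
  have hE1 : ‖∑ p ∈ P, ∑ q ∈ Q, ∑ m ∈ Finset.Icc 1 (N / p / q), centredFamily 𝒰 y (a m + p + q)‖
      ≤ 2 * averagingBound N D q₀ Q := by
    refine (Complex.norm_le_abs_re_add_abs_im _).trans ?_
    simp only [Complex.re_sum, Complex.im_sum, re_centredFamily hS h𝒰S, im_centredFamily hS h𝒰S]
    have hK : ∀ U ∈ 𝒰, U.card ≤ K := fun U hU => (Finset.mem_filter.1 hU).2.le
    have h1 := key 𝒰 h𝒰S hK (fun d => (y ^ d.primeFactors.card).re)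
      fun d => (Complex.abs_re_le_norm _).trans (hpow y hy _)
    have h2 := key 𝒰 h𝒰S hK (fun d => (y ^ d.primeFactors.card).im)
      fun d => (Complex.abs_im_le_norm _).trans (hpow y hy _)
    linarith
  have hE2 : ∑ p ∈ P, ∑ q ∈ Q, ∑ m ∈ Finset.Icc 1 (N / p / q),
      (centredFamily (S.powersetCard K) 1 (a m + p + q)).re ≤ averagingBound N D q₀ Q := by
    simp only [re_centredFamily hS h𝒱S]
    refine (le_abs_self _).trans (key _ h𝒱S
      (fun U hU => (Finset.mem_powersetCard.1 hU).2.le) _ fun d => ?_)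
    exact (Complex.abs_re_le_norm _).trans (hpow 1 (by simp) _)
  have hB : 0 ≤ averagingBound N D q₀ Q := by
    have := Real.log_natCast_nonneg N
    unfold averagingBound
    positivity
  have hyK : ‖y‖ ^ K ≤ 1 := pow_le_one₀ (norm_nonneg _) hy
  have e : ∑ p ∈ P, ∑ q ∈ Q, ∑ m ∈ Finset.Icc 1 (N / p / q),
        ((1 + y) ^ divCount S (a m + p + q) - ∏ r ∈ S, (1 + y / r))
      = ∑ p ∈ P, ∑ q ∈ Q, ∑ m ∈ Finset.Icc 1 (N / p / q),
          ((1 + y) ^ divCount S (a m + p + q) - ∏ r ∈ S, (1 + y / r)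
            - centredFamily 𝒰 y (a m + p + q))
        + ∑ p ∈ P, ∑ q ∈ Q, ∑ m ∈ Finset.Icc 1 (N / p / q),
          centredFamily 𝒰 y (a m + p + q) := by
    simp_rw [← Finset.sum_add_distrib, sub_add_cancel]
  rw [e]
  refine (norm_add_le _ _).trans ?_
  have hmain : ‖∑ p ∈ P, ∑ q ∈ Q, ∑ m ∈ Finset.Icc 1 (N / p / q),
          ((1 + y) ^ divCount S (a m + p + q) - ∏ r ∈ S, (1 + y / r)
            - centredFamily 𝒰 y (a m + p + q))‖
      ≤ ∑ p ∈ P, ∑ q ∈ Q, ∑ m ∈ Finset.Icc 1 (N / p / q), (2 * productTail S K ‖y‖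
          + ‖y‖ ^ K * (centredFamily (S.powersetCard K) 1 (a m + p + q)).re) :=
    norm_sum_le_of_le _ fun p _ => norm_sum_le_of_le _ fun q _ => norm_sum_le_of_le _ fun m _ =>
      norm_pow_divCount_sub_le hS hy1 K _
  have e2 : ∑ p ∈ P, ∑ q ∈ Q, ∑ m ∈ Finset.Icc 1 (N / p / q), (2 * productTail S K ‖y‖
          + ‖y‖ ^ K * (centredFamily (S.powersetCard K) 1 (a m + p + q)).re)
      = 2 * productTail S K ‖y‖ * (∑ p ∈ P, ∑ q ∈ Q, ((N / p / q : ℕ) : ℝ))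
        + ‖y‖ ^ K * ∑ p ∈ P, ∑ q ∈ Q, ∑ m ∈ Finset.Icc 1 (N / p / q),
          (centredFamily (S.powersetCard K) 1 (a m + p + q)).re := by
    simp only [Finset.sum_add_distrib, Finset.sum_const, Nat.card_Icc, Nat.add_sub_cancel,
      nsmul_eq_mul, Finset.mul_sum]
    congr 1
    exact Finset.sum_congr rfl fun _ _ => Finset.sum_congr rfl fun _ _ => by ring
  rw [e2] at hmain
  have h5 : ‖y‖ ^ K * ∑ p ∈ P, ∑ q ∈ Q, ∑ m ∈ Finset.Icc 1 (N / p / q),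
      (centredFamily (S.powersetCard K) 1 (a m + p + q)).re ≤ averagingBound N D q₀ Q :=
    (mul_le_mul_of_nonneg_left hE2 (by positivity)).trans (mul_le_of_le_one_left hB hyK)
  linarith

lemma sum_sum_div_div_le (P Q : Finset ℕ) (N : ℕ) :
    ∑ p ∈ P, ∑ q ∈ Q, ((N / p / q : ℕ) : ℝ)
      ≤ N * ((∑ p ∈ P, (1 : ℝ) / p) * ∑ q ∈ Q, (1 : ℝ) / q) := by
  rw [Finset.sum_mul_sum, Finset.mul_sum]
  refine Finset.sum_le_sum fun p _ => ?_
  rw [Finset.mul_sum]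
  refine Finset.sum_le_sum fun q _ => ?_
  refine Nat.cast_div_le.trans ?_
  have : ((N / p : ℕ) : ℝ) ≤ N / p := Nat.cast_div_le
  calc ((N / p : ℕ) : ℝ) / q ≤ N / p / q := by gcongr
    _ = _ := by ring

/-- The relative error of bilinear averaging over two sets of primes. -/
noncomputable def averagingError (P Q : Finset ℕ) : ℝ :=
  √(3 / ∑ p ∈ P, (1 : ℝ) / p) + √(3 / ∑ q ∈ Q, (1 : ℝ) / q)

lemma sopfr_mul_mul {p q m : ℕ} (hp : p.Prime) (hq : q.Prime) (hm : m ≠ 0) :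
    sopfr (p * (q * m)) = sopfr m + p + q := by
  rw [sopfr_prime_mul hp (mul_ne_zero hq.ne_zero hm), sopfr_prime_mul hq hm]
  ring

lemma sum_bilinear_sopfr_congr {E : Type*} [AddCommMonoid E] {P Q : Finset ℕ}
    (hP : ∀ p ∈ P, p.Prime) (hQ : ∀ q ∈ Q, q.Prime) (N : ℕ) (F : ℕ → E) :
    ∑ p ∈ P, ∑ q ∈ Q, ∑ m ∈ Finset.Icc 1 (N / p / q), F (sopfr (p * (q * m)))
      = ∑ p ∈ P, ∑ q ∈ Q, ∑ m ∈ Finset.Icc 1 (N / p / q), F (sopfr m + p + q) :=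
  Finset.sum_congr rfl fun p hp => Finset.sum_congr rfl fun q hq =>
    Finset.sum_congr rfl fun m hm => by
      rw [sopfr_mul_mul (hP p hp) (hQ q hq) (by have := (Finset.mem_Icc.1 hm).1; omega)]

lemma averagingBound_nonneg (N D : ℕ) (q₀ : ℝ) (Q : Finset ℕ) :
    0 ≤ averagingBound N D q₀ Q := by
  have := Real.log_natCast_nonneg N
  unfold averagingBound
  positivity

lemma norm_sum_pow_divCount_sopfr_le {R : ℝ} {D : ℕ} {w q₀ q₁ : ℝ} {P Q : Finset ℕ}
    (h : AveragingData R D w q₀ q₁ P Q) {S : Finset ℕ} (hS : ∀ p ∈ S, p.Prime)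
    (hR : ∀ p ∈ S, R < p) {K : ℕ} (hD : ∀ U ⊆ S, U.card ≤ K → ∏ p ∈ U, p ≤ D)
    {y : ℂ} (hy1 : ‖1 + y‖ ≤ 1) (hy : ‖y‖ ≤ 1) (N : ℕ) (hPN : P.card ≤ N)
    (hQN : ∀ p ∈ P, Q.card ≤ N / p) (hLP : 1 ≤ ∑ p ∈ P, (1 : ℝ) / p)
    (hLQ : 1 ≤ ∑ q ∈ Q, (1 : ℝ) / q) :
    ‖∑ n ∈ Finset.Icc 1 N, (1 + y) ^ divCount S (sopfr n) - N * ∏ r ∈ S, (1 + y / r)‖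
      ≤ N * (2 * averagingError P Q + 2 * productTail S K ‖y‖) + 3 * averagingBound N D q₀ Q := by
  set c : ℂ := ∏ r ∈ S, (1 + y / r)
  have hc : ‖c‖ ≤ 1 := norm_prod_one_add_div_le hS hy1
  have h1 := norm_sum_sub_bilinearAverage_le P Q h.prime_left h.prime_right N hPN hQN
    (by linarith) (by linarith) (fun n => (1 + y) ^ divCount S (sopfr n))
    (fun n => by rw [norm_pow]; exact pow_le_one₀ (norm_nonneg _) hy1)
  have h2 := norm_sum_sub_bilinearAverage_le P Q h.prime_left h.prime_right N hPN hQN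
    (by linarith) (by linarith) (fun _ => c) (fun _ => hc)
  have h3 : ‖bilinearAverage P Q N (fun n => (1 + y) ^ divCount S (sopfr n))
      - bilinearAverage P Q N (fun _ => c)‖
      ≤ N * (2 * productTail S K ‖y‖) + 3 * averagingBound N D q₀ Q := by
    unfold bilinearAverage
    rw [sum_bilinear_sopfr_congr h.prime_left h.prime_right N
      (fun a => (1 + y) ^ divCount S a), ← smul_sub, norm_smul, Real.norm_of_nonneg (by positivity)]
    simp_rw [← Finset.sum_sub_distrib]
    refine (mul_le_mul_of_nonneg_left
      (h.norm_sum_pow_divCount_le hS hR hD hy1 hy N sopfr) (by positivity)).trans ?_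
    set LP := ∑ p ∈ P, (1 : ℝ) / p
    set LQ := ∑ q ∈ Q, (1 : ℝ) / q
    have hT := sum_sum_div_div_le P Q N
    set T := ∑ p ∈ P, ∑ q ∈ Q, ((N / p / q : ℕ) : ℝ)
    have hLL : 1 ≤ LP * LQ := one_le_mul_of_one_le_of_one_le hLP hLQ
    have hB := averagingBound_nonneg N D q₀ Q
    have ht := productTail_nonneg S K (norm_nonneg y)
    rw [← mul_inv, inv_mul_le_iff₀ (by linarith)]
    have h4 := mul_le_mul_of_nonneg_left hT (by positivity : 0 ≤ 2 * productTail S K ‖y‖)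
    have h5 : 3 * averagingBound N D q₀ Q ≤ LP * LQ * (3 * averagingBound N D q₀ Q) :=
      le_mul_of_one_le_left (by positivity) hLL
    linarith
  have e : ∑ n ∈ Finset.Icc 1 N, (1 + y) ^ divCount S (sopfr n) - N * c
      = (∑ n ∈ Finset.Icc 1 N, (1 + y) ^ divCount S (sopfr n)
          - bilinearAverage P Q N (fun n => (1 + y) ^ divCount S (sopfr n)))
        - (∑ n ∈ Finset.Icc 1 N, c - bilinearAverage P Q N (fun _ => c))
        + (bilinearAverage P Q N (fun n => (1 + y) ^ divCount S (sopfr n))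
          - bilinearAverage P Q N (fun _ => c)) := by
    rw [Finset.sum_const, Nat.card_Icc, Nat.add_sub_cancel, nsmul_eq_mul]
    ring
  rw [e]
  refine (norm_add_le _ _).trans ?_
  have h6 := norm_sub_le (∑ n ∈ Finset.Icc 1 N, (1 + y) ^ divCount S (sopfr n)
          - bilinearAverage P Q N (fun n => (1 + y) ^ divCount S (sopfr n)))
        (∑ n ∈ Finset.Icc 1 N, c - bilinearAverage P Q N (fun _ => c))
  unfold averagingError
  linarith

lemma AveragingData.sum_divCount_le {R : ℝ} {D : ℕ} {w q₀ q₁ : ℝ} {P Q : Finset ℕ}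
    (h : AveragingData R D w q₀ q₁ P Q) {S : Finset ℕ} (hS : ∀ p ∈ S, p.Prime)
    (hR : ∀ p ∈ S, R < p) (hD : ∀ p ∈ S, p ≤ D) (N : ℕ) (a : ℕ → ℕ) :
    ∑ p ∈ P, ∑ q ∈ Q, ∑ m ∈ Finset.Icc 1 (N / p / q), (divCount S (a m + p + q) : ℝ)
      ≤ (∑ r ∈ S, (1 : ℝ) / r) * (∑ p ∈ P, ∑ q ∈ Q, ((N / p / q : ℕ) : ℝ))
        + averagingBound N D q₀ Q := by
  have e : ∀ b, (divCount S b : ℝ) = ∑ r ∈ S, (1 : ℝ) / r + centredSum (fun _ => 1) S b := by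
    intro b
    unfold divCount centredSum dvdInd
    rw [← Finset.sum_add_distrib, ← Finset.sum_boole]
    exact Finset.sum_congr rfl fun r _ => by ring
  have hb := h.abs_sum_le (fun _ => 1) S (fun _ _ => by simp)
    (fun d hd => ⟨(hS d hd).one_lt.le, hD d hd⟩) (fun d hd d' hd' => by
      rcases eq_or_ne d d' with rfl | hne
      · right; rw [Nat.gcd_self]; exact hR d hd
      · exact Or.inl ((Nat.coprime_primes (hS d hd) (hS d' hd')).2 hne)) N a
  simp_rw [e, Finset.sum_add_distrib, Finset.sum_const, Nat.card_Icc, Nat.add_sub_cancel,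
    nsmul_eq_mul, ← Finset.sum_mul]
  have := (abs_le.1 hb).2
  linarith

lemma card_filter_divCount_sopfr_le {R : ℝ} {D : ℕ} {w q₀ q₁ : ℝ} {P Q : Finset ℕ}
    (h : AveragingData R D w q₀ q₁ P Q) {S : Finset ℕ} (hS : ∀ p ∈ S, p.Prime)
    (hR : ∀ p ∈ S, R < p) (hD : ∀ p ∈ S, p ≤ D) (N : ℕ) (hPN : P.card ≤ N)
    (hQN : ∀ p ∈ P, Q.card ≤ N / p) (hLP : 1 ≤ ∑ p ∈ P, (1 : ℝ) / p)
    (hLQ : 1 ≤ ∑ q ∈ Q, (1 : ℝ) / q) {V : ℝ} (hV : 0 < V) :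
    (((Finset.Icc 1 N).filter fun n => V ≤ divCount S (sopfr n)).card : ℝ)
      ≤ N * averagingError P Q + (N * (∑ r ∈ S, (1 : ℝ) / r) + averagingBound N D q₀ Q) / V := by
  set g : ℕ → ℝ := fun a => if V ≤ divCount S a then 1 else 0 with hg
  have hg1 : ∀ a, g a ≤ (divCount S a : ℝ) / V := by
    intro a
    rw [hg]; dsimp only
    split_ifs with h
    · rwa [one_le_div hV]
    · positivity
  have h1 := norm_sum_sub_bilinearAverage_le P Q h.prime_left h.prime_right N hPN hQN
    (by linarith) (by linarith) (fun n => g (sopfr n))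
    (fun n => by rw [hg]; dsimp only; split_ifs <;> simp)
  have h2 : bilinearAverage P Q N (fun n => g (sopfr n))
      ≤ (N * (∑ r ∈ S, (1 : ℝ) / r) + averagingBound N D q₀ Q) / V := by
    unfold bilinearAverage
    rw [sum_bilinear_sopfr_congr h.prime_left h.prime_right N g, smul_eq_mul]
    set LP := ∑ p ∈ P, (1 : ℝ) / p
    set LQ := ∑ q ∈ Q, (1 : ℝ) / q
    have hLL : 1 ≤ LP * LQ := one_le_mul_of_one_le_of_one_le hLP hLQ
    have hT := sum_sum_div_div_le P Q N
    have hB := averagingBound_nonneg N D q₀ Q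
    have h3 := h.sum_divCount_le hS hR hD N sopfr
    have hs : 0 ≤ ∑ r ∈ S, (1 : ℝ) / r := Finset.sum_nonneg fun _ _ => by positivity
    have h4 := mul_le_mul_of_nonneg_left hT hs
    have h5 : ∑ p ∈ P, ∑ q ∈ Q, ∑ m ∈ Finset.Icc 1 (N / p / q), g (sopfr m + p + q)
        ≤ (∑ p ∈ P, ∑ q ∈ Q, ∑ m ∈ Finset.Icc 1 (N / p / q),
          (divCount S (sopfr m + p + q) : ℝ)) / V := by
      simp_rw [Finset.sum_div]
      exact Finset.sum_le_sum fun p _ => Finset.sum_le_sum fun q _ =>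
        Finset.sum_le_sum fun m _ => hg1 _
    rw [← mul_inv, inv_mul_le_iff₀ (by linarith)]
    refine h5.trans ?_
    rw [← mul_div_assoc]
    gcongr
    have h6 : averagingBound N D q₀ Q ≤ LP * LQ * averagingBound N D q₀ Q :=
      le_mul_of_one_le_left hB hLL
    linarith
  rw [← Finset.sum_boole]
  rw [Real.norm_eq_abs] at h1
  have := (abs_le.1 h1).2
  unfold averagingError
  linarith

lemma sum_min_div_le (N Y : ℕ) :
    ∑ m ∈ Finset.Icc 1 N, ((min (N / m) Y : ℕ) : ℝ) ≤ N * (1 + Real.log Y) := by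
  have h1 : ∀ m ∈ Finset.Icc 1 N, ((min (N / m) Y : ℕ) : ℝ)
      = ∑ l ∈ Finset.Icc 1 Y, if l ≤ N / m then 1 else 0 := by
    intro m _
    rw [Finset.sum_boole]
    congr 1
    have : (Finset.Icc 1 Y).filter (· ≤ N / m) = Finset.Icc 1 (min (N / m) Y) := by
      ext l; simp only [Finset.mem_filter, Finset.mem_Icc, le_min_iff]; tauto
    rw [this, Nat.card_Icc, Nat.add_sub_cancel]
  rw [Finset.sum_congr rfl h1, Finset.sum_comm]
  have h2 : ∀ l ∈ Finset.Icc 1 Y,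
      ∑ m ∈ Finset.Icc 1 N, (if l ≤ N / m then (1 : ℝ) else 0) ≤ N * (1 / l) := by
    intro l hl
    have hl1 := (Finset.mem_Icc.1 hl).1
    rw [Finset.sum_boole]
    have : (Finset.Icc 1 N).filter (fun m => l ≤ N / m) ⊆ Finset.Icc 1 (N / l) := by
      intro m hm
      rw [Finset.mem_filter, Finset.mem_Icc] at hm
      rw [Finset.mem_Icc]
      refine ⟨hm.1.1, ?_⟩
      have := hm.2
      rw [Nat.le_div_iff_mul_le hm.1.1] at this
      rw [Nat.le_div_iff_mul_le hl1, mul_comm]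
      exact this
    have := Finset.card_le_card this
    rw [Nat.card_Icc, Nat.add_sub_cancel] at this
    calc _ ≤ ((N / l : ℕ) : ℝ) := by exact_mod_cast this
      _ ≤ N / l := Nat.cast_div_le
      _ = _ := by ring
  refine (Finset.sum_le_sum h2).trans ?_
  rw [← Finset.mul_sum]
  gcongr
  have := harmonic_le_one_add_log Y
  rw [harmonic_eq_sum_Icc] at this
  push_cast at this
  simpa using this

/-- In an interval longer than all products of `k` primes from `S`, few integers have at least
`k` prime divisors in `S`. -/
lemma card_filter_divCount_add_le {S : Finset ℕ} (hS : ∀ p ∈ S, p.Prime) {k Y : ℕ}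
    (hY : ∀ U ⊆ S, U.card = k → ∏ p ∈ U, p ≤ Y) (b : ℕ) :
    (((Finset.Icc 1 Y).filter fun l => k ≤ divCount S (b + l)).card : ℝ)
      ≤ Y * (2 * productTail S k 1) := by
  have h1 : (((Finset.Icc 1 Y).filter fun l => k ≤ divCount S (b + l)).card : ℝ)
      ≤ ∑ U ∈ S.powersetCard k, ∑ l ∈ Finset.Icc 1 Y, dvdInd (∏ p ∈ U, p) (b + l) := by
    rw [Finset.sum_comm, ← Finset.sum_boole]
    refine Finset.sum_le_sum fun l _ => ?_
    rw [sum_powersetCard_dvdInd hS]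
    split_ifs with h
    · exact_mod_cast Nat.choose_pos h
    · positivity
  refine h1.trans ?_
  have h2 : ∀ U ∈ S.powersetCard k, ∑ l ∈ Finset.Icc 1 Y, dvdInd (∏ p ∈ U, p) (b + l)
      ≤ Y * (2 * (1 / ((∏ p ∈ U, p : ℕ) : ℝ))) := by
    intro U hU
    rw [Finset.mem_powersetCard] at hU
    have hpos : 0 < ∏ p ∈ U, p := Finset.prod_pos fun p hp => (hS p (hU.1 hp)).pos
    have h3 := (abs_le.1 (abs_sum_dvdInd_sub_le Y (∏ p ∈ U, p) b hpos)).2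
    have h4 : (1 : ℝ) ≤ Y / ((∏ p ∈ U, p : ℕ) : ℝ) := by
      rw [one_le_div (by exact_mod_cast hpos)]
      exact_mod_cast hY U hU.1 hU.2
    have e : Y * (2 * (1 / ((∏ p ∈ U, p : ℕ) : ℝ))) = 2 * (Y / ((∏ p ∈ U, p : ℕ) : ℝ)) := by ring
    rw [e]
    linarith
  refine (Finset.sum_le_sum h2).trans ?_
  rw [← Finset.mul_sum, ← Finset.mul_sum]
  gcongr
  unfold productTail
  simp only [one_pow]
  refine Finset.sum_le_sum_of_subset_of_nonneg (fun U hU => ?_) fun U _ _ => by positivity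
  rw [Finset.mem_powersetCard] at hU
  exact Finset.mem_filter.2 ⟨Finset.mem_powerset.2 hU.1, hU.2.ge⟩

lemma sum_prime_sopfr_swap {Q : Finset ℕ} (hQ : ∀ q ∈ Q, q.Prime) (N : ℕ) (g : ℕ → ℝ) :
    ∑ q ∈ Q, ∑ m ∈ Finset.Icc 1 (N / q), g (sopfr (q * m))
      = ∑ m ∈ Finset.Icc 1 N, ∑ q ∈ Q.filter (· ≤ N / m), g (sopfr m + q) := by
  simp_rw [Finset.sum_filter]
  rw [Finset.sum_comm (s := Finset.Icc 1 N)]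
  refine Finset.sum_congr rfl fun q hqQ => ?_
  have hq0 := (hQ q hqQ).pos
  rw [← Finset.sum_filter]
  refine Finset.sum_congr ?_ fun m hm => ?_
  · ext m
    simp only [Finset.mem_filter, Finset.mem_Icc]
    constructor
    · rintro ⟨h1, h2⟩
      rw [Nat.le_div_iff_mul_le hq0] at h2
      refine ⟨⟨h1, (Nat.le_mul_of_pos_right m hq0).trans h2⟩, ?_⟩
      rw [Nat.le_div_iff_mul_le h1, mul_comm]
      exact h2
    · rintro ⟨⟨h1, _⟩, h2⟩
      rw [Nat.le_div_iff_mul_le h1, mul_comm] at h2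
      exact ⟨h1, by rwa [Nat.le_div_iff_mul_le hq0]⟩
  · rw [sopfr_prime_mul (hQ q hqQ) (by have := (Finset.mem_Icc.1 (Finset.mem_filter.1 hm).1).1; omega)]

lemma card_filter_small_divCount_sopfr_le {S Q : Finset ℕ} (hS : ∀ p ∈ S, p.Prime)
    (hQ : ∀ q ∈ Q, q.Prime) {k q₀ q₁ : ℕ} (hq : ∀ q ∈ Q, q₀ ≤ q ∧ q ≤ q₁)
    (hk : ∀ U ⊆ S, U.card = k → ∏ p ∈ U, p ≤ q₀) (N : ℕ) (hQN : Q.card ≤ N)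
    (hLQ : 1 ≤ ∑ q ∈ Q, (1 : ℝ) / q) :
    (((Finset.Icc 1 N).filter fun n => k ≤ divCount S (sopfr n)).card : ℝ)
      ≤ N * (√(3 / ∑ q ∈ Q, (1 : ℝ) / q) + (1 + Real.log q₁) * (2 * productTail S k 1)) := by
  set g : ℕ → ℝ := fun a => if k ≤ divCount S a then 1 else 0 with hg
  have hg0 : ∀ a, 0 ≤ g a := fun a => by rw [hg]; dsimp only; split_ifs <;> simp
  have h1 := norm_sum_sub_prime_average_le Q hQ N hQN (by linarith) (fun n => g (sopfr n))
    (fun n => by rw [hg]; dsimp only; split_ifs <;> simp)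
  have hT : 0 ≤ 2 * productTail S k 1 := by
    have := productTail_nonneg S k zero_le_one
    positivity
  have h2 : ∑ q ∈ Q, ∑ m ∈ Finset.Icc 1 (N / q), g (sopfr (q * m))
      ≤ N * ((1 + Real.log q₁) * (2 * productTail S k 1)) := by
    have e1 := sum_prime_sopfr_swap hQ N g
    rw [e1]
    have h3 : ∀ m ∈ Finset.Icc 1 N, ∑ q ∈ Q.filter (· ≤ N / m), g (sopfr m + q)
        ≤ ((min (N / m) q₁ : ℕ) : ℝ) * (2 * productTail S k 1) := by
      intro m _
      rcases (Q.filter (· ≤ N / m)).eq_empty_or_nonempty with he | ⟨q, hqm⟩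
      · rw [he, Finset.sum_empty]; positivity
      · rw [Finset.mem_filter] at hqm
        have hqq := hq q hqm.1
        refine le_trans ?_ (card_filter_divCount_add_le hS (k := k) (Y := min (N / m) q₁)
          (fun U hU hUk => (hk U hU hUk).trans (hqq.1.trans (le_min hqm.2 hqq.2))) (sopfr m))
        rw [← Finset.sum_boole]
        refine Finset.sum_le_sum_of_subset_of_nonneg (fun r hr => ?_) fun r _ _ => hg0 _
        rw [Finset.mem_filter] at hr
        exact Finset.mem_Icc.2 ⟨(hQ r hr.1).pos, le_min hr.2 (hq r hr.1).2⟩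
    refine (Finset.sum_le_sum h3).trans ?_
    rw [← Finset.sum_mul, ← mul_assoc (N : ℝ)]
    exact mul_le_mul_of_nonneg_right (sum_min_div_le N q₁) hT
  have h3 : (∑ q ∈ Q, (1 : ℝ) / q)⁻¹ • ∑ q ∈ Q, ∑ m ∈ Finset.Icc 1 (N / q), g (sopfr (q * m))
      ≤ N * ((1 + Real.log q₁) * (2 * productTail S k 1)) := by
    rw [smul_eq_mul]
    refine le_trans (mul_le_of_le_one_left ?_ (inv_le_one_of_one_le₀ hLQ)) h2
    exact Finset.sum_nonneg fun _ _ => Finset.sum_nonneg fun _ _ => hg0 _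
  rw [← Finset.sum_boole]
  rw [Real.norm_eq_abs] at h1
  have := (abs_le.1 h1).2
  linarith

lemma card_filter_primeFactors_mul_log_le {a : ℕ} (ha : a ≠ 0) {w : ℝ} (hw : 1 ≤ w) :
    ((a.primeFactors.filter fun p : ℕ => w < p).card : ℝ) * Real.log w ≤ Real.log a := by
  have h1 : w ^ (a.primeFactors.filter fun p : ℕ => w < p).card ≤ a := by
    calc w ^ (a.primeFactors.filter fun p : ℕ => w < p).card
        = ∏ p ∈ a.primeFactors.filter (fun p : ℕ => w < p), w := by rw [Finset.prod_const]
      _ ≤ ∏ p ∈ a.primeFactors.filter (fun p : ℕ => w < p), (p : ℝ) :=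
          Finset.prod_le_prod (fun _ _ => by linarith) fun p hp => (Finset.mem_filter.1 hp).2.le
      _ = ((∏ p ∈ a.primeFactors.filter (fun p : ℕ => w < p), p : ℕ) : ℝ) := by push_cast; rfl
      _ ≤ a := by
          have : ∏ p ∈ a.primeFactors.filter (fun p : ℕ => w < p), p ∣ a :=
            (Finset.prod_dvd_prod_of_subset _ _ _ (Finset.filter_subset _ _)).trans
              (Nat.prod_primeFactors_dvd a)
          exact_mod_cast Nat.le_of_dvd (Nat.pos_of_ne_zero ha) this
  rw [← Real.log_pow]
  exact Real.log_le_log (by positivity) h1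

lemma divCount_le_card_primeFactors {S : Finset ℕ} (hS : ∀ p ∈ S, p.Prime) {a : ℕ} (ha : a ≠ 0) :
    divCount S a ≤ a.primeFactors.card := by
  unfold divCount
  refine Finset.card_le_card fun p hp => ?_
  rw [Finset.mem_filter] at hp
  exact Nat.mem_primeFactors.2 ⟨hS p hp.1, hp.2, ha⟩

lemma card_primeFactors_le_divCount {R z w : ℝ} (hR : 0 ≤ R) (hz : 0 ≤ z) (a : ℕ) :
    a.primeFactors.card ≤ divCount (primesBetween 0 R) a + divCount (primesBetween R z) a
      + divCount (primesBetween z w) a + (a.primeFactors.filter fun p : ℕ => w < p).card := by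
  unfold divCount
  have hsub : a.primeFactors ⊆ (((primesBetween 0 R).filter (· ∣ a))
      ∪ ((primesBetween R z).filter (· ∣ a))) ∪ ((primesBetween z w).filter (· ∣ a))
      ∪ (a.primeFactors.filter fun p : ℕ => w < p) := by
    intro p hp
    have h := Nat.mem_primeFactors.1 hp
    simp only [Finset.mem_union, Finset.mem_filter, mem_primesBetween le_rfl, mem_primesBetween hR,
      mem_primesBetween hz, hp, h.1, h.2.1, true_and, and_true]
    have : (0 : ℝ) < p := by exact_mod_cast h.1.pos
    rcases le_or_gt (p : ℝ) R with h1 | h1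
    · exact Or.inl (Or.inl (Or.inl ⟨this, h1⟩))
    rcases le_or_gt (p : ℝ) z with h2 | h2
    · exact Or.inl (Or.inl (Or.inr ⟨h1, h2⟩))
    rcases le_or_gt (p : ℝ) w with h3 | h3
    · exact Or.inl (Or.inr ⟨h2, h3⟩)
    · exact Or.inr h3
  refine (Finset.card_le_card hsub).trans ((Finset.card_union_le _ _).trans ?_)
  gcongr
  refine (Finset.card_union_le _ _).trans ?_
  gcongr
  exact Finset.card_union_le _ _

/-- The primes used in the first averaging step. -/
noncomputable def outerPrimes (v : ℝ) : Finset ℕ :=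
  primesBetween (Real.exp (Real.exp (v ^ 8) / v)) (Real.exp (Real.exp (v ^ 8) / 4))

/-- The primes used in the second averaging step. -/
noncomputable def innerPrimes (v : ℝ) : Finset ℕ :=
  primesBetween (Real.exp (v ^ 24)) (Real.exp (v ^ 32))

/-- The prime divisors that determine the limiting distribution. -/
noncomputable def mainPrimes (v : ℝ) : Finset ℕ :=
  primesBetween (Real.exp (v ^ 40)) (Real.exp (Real.exp (v ^ 8) / v ^ 24))

/-- Large primes whose contribution is negligible on average. -/
noncomputable def largePrimes (v : ℝ) : Finset ℕ :=
  primesBetween (Real.exp (Real.exp (v ^ 8) / v ^ 24)) (Real.exp (Real.exp (v ^ 8) / v ^ 2))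

/-- Small primes whose contribution is negligible. -/
noncomputable def smallPrimes (v : ℝ) : Finset ℕ := primesBetween 0 (Real.exp (v ^ 40))

/-- The bound for all moduli in the main range. -/
noncomputable def modulusBound (v : ℝ) : ℕ := ⌊Real.exp (Real.exp (v ^ 8) / v ^ 2)⌋₊

/-- The integer part of `x = exp (exp (v ^ 8))`. -/
noncomputable def cutoff (v : ℝ) : ℕ := ⌊Real.exp (Real.exp (v ^ 8))⌋₊

lemma primesBetween_prime {a b : ℝ} {p : ℕ} (hp : p ∈ primesBetween a b) : p.Prime :=
  (Finset.mem_filter.1 hp).2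

lemma card_primesBetween_le (a b : ℝ) : (primesBetween a b).card ≤ ⌊b⌋₊ := by
  unfold primesBetween
  refine (Finset.card_filter_le _ _).trans ?_
  rw [Nat.card_Ioc]
  omega

lemma eventually_growth :
    ∀ᶠ v : ℝ in atTop, 1000 ≤ v ∧ v ^ 100 ≤ Real.exp (v ^ 8) := by
  have h := (Real.isLittleO_pow_exp_atTop (n := 100)).bound (c := 1) one_pos
  filter_upwards [h, eventually_ge_atTop 1000] with v h1 h2
  refine ⟨h2, ?_⟩
  rw [one_mul, Real.norm_of_nonneg (by positivity), Real.norm_of_nonneg (by positivity)] at h1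
  exact h1.trans (Real.exp_le_exp.2 (le_self_pow₀ (by linarith) (by norm_num)))

lemma pow_mul_le_pow {v : ℝ} (hv : 1000 ≤ v) {m n : ℕ} (h : m < n) : 1000 * v ^ m ≤ v ^ n := by
  calc 1000 * v ^ m ≤ v * v ^ m := by gcongr
    _ = v ^ (m + 1) := by ring
    _ ≤ v ^ n := pow_le_pow_right₀ (by linarith) h

lemma abs_sum_inv_primesBetween_exp_sub_le {a b : ℝ} (ha : 1 ≤ a) (hab : a ≤ b) :
    |∑ p ∈ primesBetween (Real.exp a) (Real.exp b), (1 : ℝ) / p - (Real.log b - Real.log a)|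
      ≤ 5 := by
  have h := abs_sum_inv_primesBetween_sub_le (a := Real.exp a) (b := Real.exp b)
    (by have := Real.add_one_le_exp a; linarith) (Real.exp_le_exp.2 hab)
  rwa [Real.log_exp, Real.log_exp] at h

lemma abs_sum_inv_outerPrimes_sub_le {v : ℝ} (hv : 1000 ≤ v) (hE : v ^ 100 ≤ Real.exp (v ^ 8)) :
    |∑ p ∈ outerPrimes v, (1 : ℝ) / p - (Real.log v - Real.log 4)| ≤ 5 := by
  have hv0 : 0 < v := by linarith
  have h0 := Real.exp_pos (v ^ 8)
  have h1 : 1 ≤ Real.exp (v ^ 8) / v := by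
    rw [le_div_iff₀ hv0]
    have := pow_mul_le_pow hv (m := 1) (n := 100) (by norm_num)
    linarith
  have h2 : Real.exp (v ^ 8) / v ≤ Real.exp (v ^ 8) / 4 := by gcongr; linarith
  have h := abs_sum_inv_primesBetween_exp_sub_le h1 h2
  rw [Real.log_div h0.ne' (by norm_num), Real.log_div h0.ne' hv0.ne'] at h
  refine le_of_eq_of_le ?_ h
  congr 1
  unfold outerPrimes
  ring

lemma abs_sum_inv_innerPrimes_sub_le {v : ℝ} (hv : 1000 ≤ v) :
    |∑ p ∈ innerPrimes v, (1 : ℝ) / p - 8 * Real.log v| ≤ 5 := by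
  have h := abs_sum_inv_primesBetween_exp_sub_le (a := v ^ 24) (b := v ^ 32)
    (one_le_pow₀ (by linarith)) (pow_le_pow_right₀ (by linarith) (by norm_num))
  rw [Real.log_pow, Real.log_pow] at h
  refine le_of_eq_of_le ?_ h
  congr 1
  unfold innerPrimes
  push_cast
  ring

lemma abs_sum_inv_mainPrimes_sub_le {v : ℝ} (hv : 1000 ≤ v) (hE : v ^ 100 ≤ Real.exp (v ^ 8)) :
    |∑ p ∈ mainPrimes v, (1 : ℝ) / p - (v ^ 8 - 64 * Real.log v)| ≤ 5 := by
  have hv0 : 0 < v := by linarith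
  have h1 : v ^ 40 ≤ Real.exp (v ^ 8) / v ^ 24 := by
    rw [le_div_iff₀ (by positivity), ← pow_add]
    exact (pow_le_pow_right₀ (by linarith) (by norm_num)).trans hE
  have h := abs_sum_inv_primesBetween_exp_sub_le (one_le_pow₀ (by linarith)) h1
  rw [Real.log_div (Real.exp_pos _).ne' (by positivity), Real.log_exp, Real.log_pow,
    Real.log_pow] at h
  refine le_of_eq_of_le ?_ h
  congr 1
  unfold mainPrimes
  push_cast
  ring

lemma abs_sum_inv_largePrimes_sub_le {v : ℝ} (hv : 1000 ≤ v) (hE : v ^ 100 ≤ Real.exp (v ^ 8)) :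
    |∑ p ∈ largePrimes v, (1 : ℝ) / p - 22 * Real.log v| ≤ 5 := by
  have hv0 : 0 < v := by linarith
  have h1 : 1 ≤ Real.exp (v ^ 8) / v ^ 24 := by
    rw [le_div_iff₀ (by positivity), one_mul]
    exact (pow_le_pow_right₀ (by linarith) (by norm_num)).trans hE
  have h2 : Real.exp (v ^ 8) / v ^ 24 ≤ Real.exp (v ^ 8) / v ^ 2 := by
    gcongr
    · linarith
    · norm_num
  have h := abs_sum_inv_primesBetween_exp_sub_le h1 h2
  rw [Real.log_div (Real.exp_pos _).ne' (by positivity),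
    Real.log_div (Real.exp_pos _).ne' (by positivity), Real.log_pow, Real.log_pow] at h
  refine le_of_eq_of_le ?_ h
  congr 1
  unfold largePrimes
  push_cast
  ring

lemma sum_inv_smallPrimes_le {v : ℝ} (hv : 1000 ≤ v) :
    ∑ p ∈ smallPrimes v, (1 : ℝ) / p ≤ 40 * Real.log v + 4 := by
  have hv0 : 0 < v := by linarith
  have h40 : 1 ≤ v ^ 40 := one_le_pow₀ (by linarith)
  have h2 : (2 : ℝ) ≤ Real.exp (v ^ 40) := by
    have := Real.add_one_le_exp (v ^ 40); linarith
  have hN : 2 ≤ ⌊Real.exp (v ^ 40)⌋₊ := Nat.le_floor (by exact_mod_cast h2)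
  have hN' : (2 : ℝ) ≤ ⌊Real.exp (v ^ 40)⌋₊ := by exact_mod_cast hN
  have h1 := sum_inv_primesLE_le _ hN
  have h3 : Real.log (Real.log ⌊Real.exp (v ^ 40)⌋₊) ≤ 40 * Real.log v := by
    have hlog : Real.log ⌊Real.exp (v ^ 40)⌋₊ ≤ v ^ 40 := by
      rw [Real.log_le_iff_le_exp (by linarith)]
      exact Nat.floor_le (by positivity)
    have := Real.log_le_log (Real.log_pos (by linarith)) hlog
    rw [Real.log_pow] at this
    exact_mod_cast this
  have h4 : ∑ p ∈ smallPrimes v, (1 : ℝ) / p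
      ≤ ∑ p ∈ (⌊Real.exp (v ^ 40)⌋₊).primesLE, (1 : ℝ) / p := by
    refine Finset.sum_le_sum_of_subset_of_nonneg (fun p hp => ?_) fun _ _ _ => by positivity
    have hp' := primesBetween_prime hp
    rw [smallPrimes, mem_primesBetween le_rfl] at hp
    rw [Nat.mem_primesLE]
    exact ⟨Nat.le_floor hp.2.2, hp'⟩
  linarith

lemma eventually_one_le_sum_inv :
    ∀ᶠ v : ℝ in atTop, 1 ≤ ∑ p ∈ outerPrimes v, (1 : ℝ) / p
      ∧ 1 ≤ ∑ p ∈ innerPrimes v, (1 : ℝ) / p := by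
  filter_upwards [eventually_growth, Real.tendsto_log_atTop.eventually_ge_atTop (6 + Real.log 4)]
    with v hv hl
  have h1 := abs_le.1 (abs_sum_inv_outerPrimes_sub_le hv.1 hv.2)
  have h2 := abs_le.1 (abs_sum_inv_innerPrimes_sub_le hv.1)
  have := Real.log_nonneg (by norm_num : (1 : ℝ) ≤ 4)
  constructor <;> linarith [h1.1, h2.1]

lemma tendsto_averagingError :
    Tendsto (fun v => averagingError (outerPrimes v) (innerPrimes v)) atTop (nhds 0) := by
  have key : ∀ (f : ℝ → ℝ), Tendsto f atTop atTop →
      Tendsto (fun v => √(3 / f v)) atTop (nhds 0) := by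
    intro f hf
    have := (tendsto_const_nhds (x := (3 : ℝ))).div_atTop hf
    have := (Real.continuous_sqrt.tendsto 0).comp this
    rwa [Real.sqrt_zero] at this
  have h1 : Tendsto (fun v => ∑ p ∈ outerPrimes v, (1 : ℝ) / p) atTop atTop := by
    refine tendsto_atTop_mono' _ ?_ (tendsto_atTop_add_const_right _ (-(Real.log 4 + 5))
      Real.tendsto_log_atTop)
    filter_upwards [eventually_growth] with v hv
    linarith [(abs_le.1 (abs_sum_inv_outerPrimes_sub_le hv.1 hv.2)).1]
  have h2 : Tendsto (fun v => ∑ p ∈ innerPrimes v, (1 : ℝ) / p) atTop atTop := by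
    refine tendsto_atTop_mono' _ ?_ (tendsto_atTop_add_const_right _ (-5)
      Real.tendsto_log_atTop)
    filter_upwards [eventually_growth] with v hv
    have := Real.log_nonneg (by linarith [hv.1] : (1 : ℝ) ≤ v)
    linarith [(abs_le.1 (abs_sum_inv_innerPrimes_sub_le hv.1)).1]
  have h3 := (key _ h1).add (key _ h2)
  rwa [add_zero] at h3

lemma log_natFloor_exp_le (a : ℝ) (ha : 0 ≤ a) : Real.log ⌊Real.exp a⌋₊ ≤ a := by
  rcases Nat.eq_zero_or_pos ⌊Real.exp a⌋₊ with h | h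
  · rw [h]; simpa using ha
  · rw [Real.log_le_iff_le_exp (by exact_mod_cast h)]
    exact Nat.floor_le (by positivity)

lemma eventually_averagingBound_le :
    ∀ᶠ v : ℝ in atTop, averagingBound (cutoff v) (modulusBound v) (Real.exp (v ^ 24))
      (innerPrimes v) ≤ cutoff v * (10 * Real.exp (-v)) := by
  filter_upwards [eventually_growth] with v hv
  obtain ⟨hv, hE⟩ := hv
  have hv0 : 0 < v := by linarith
  set E := Real.exp (v ^ 8) with hEdef
  have hE1 : 1000 * v ≤ E := by
    have := pow_mul_le_pow hv (m := 1) (n := 100) (by norm_num)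
    linarith
  have hN : Real.log (cutoff v) ≤ E := log_natFloor_exp_le _ (by positivity)
  have hD : Real.log (modulusBound v) ≤ E := by
    refine (log_natFloor_exp_le _ (by positivity)).trans (div_le_self (by positivity) ?_)
    exact one_le_pow₀ (by linarith)
  have hL : ∑ q ∈ innerPrimes v, (1 : ℝ) / q + 1 ≤ E := by
    have h1 := (abs_le.1 (abs_sum_inv_innerPrimes_sub_le hv)).2
    have h2 := Real.log_le_sub_one_of_pos hv0
    linarith
  have hL0 : 0 ≤ ∑ q ∈ innerPrimes v, (1 : ℝ) / q + 1 := by positivity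
  have hD0 := Real.log_natCast_nonneg (modulusBound v)
  have hN0 := Real.log_natCast_nonneg (cutoff v)
  unfold averagingBound
  rw [mul_assoc]
  refine mul_le_mul_of_nonneg_left ?_ (Nat.cast_nonneg _)
  have h1 : ((1 + Real.log (modulusBound v)) ^ 3 * (∑ q ∈ innerPrimes v, (1 : ℝ) / q + 1) + 1)
      / Real.exp (v ^ 24) ≤ (5 * E ^ 2 * Real.exp (-(v ^ 24 / 2))) ^ 2 := by
    have e : (5 * E ^ 2 * Real.exp (-(v ^ 24 / 2))) ^ 2 = 25 * E ^ 4 / Real.exp (v ^ 24) := by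
      have : Real.exp (-(v ^ 24 / 2)) ^ 2 = (Real.exp (v ^ 24))⁻¹ := by
        rw [← Real.exp_nat_mul, ← Real.exp_neg]
        push_cast
        ring_nf
      rw [mul_pow, this]
      ring
    rw [e]
    gcongr
    have h2 : (1 + Real.log (modulusBound v)) ^ 3 ≤ (2 * E) ^ 3 := by
      gcongr; linarith
    have h3 : (1 + Real.log (modulusBound v)) ^ 3 * (∑ q ∈ innerPrimes v, (1 : ℝ) / q + 1)
        ≤ (2 * E) ^ 3 * E := by gcongr
    have h4 : 1 ≤ E ^ 4 := one_le_pow₀ (by linarith)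
    nlinarith
  have h2 := Real.sqrt_le_sqrt h1
  rw [Real.sqrt_sq (by positivity)] at h2
  have h3 : 1 + Real.log (cutoff v) ≤ 2 * E := by linarith
  refine (mul_le_mul h3 h2 (Real.sqrt_nonneg _) (by positivity)).trans ?_
  have e : 2 * E * (5 * E ^ 2 * Real.exp (-(v ^ 24 / 2)))
      = 10 * Real.exp (3 * v ^ 8 - v ^ 24 / 2) := by
    have : E ^ 3 * Real.exp (-(v ^ 24 / 2)) = Real.exp (3 * v ^ 8 - v ^ 24 / 2) := by
      rw [hEdef, ← Real.exp_nat_mul, ← Real.exp_add]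
      push_cast
      ring_nf
    rw [← this]; ring
  rw [e]
  gcongr
  have h5 := pow_mul_le_pow hv (m := 8) (n := 24) (by norm_num)
  have h6 := pow_mul_le_pow hv (m := 1) (n := 24) (by norm_num)
  rw [pow_one] at h6
  linarith

lemma eventually_averagingData :
    ∀ᶠ v : ℝ in atTop, AveragingData (Real.exp (v ^ 40)) (modulusBound v)
      (Real.exp (Real.exp (v ^ 8) / v)) (Real.exp (v ^ 24)) (Real.exp (v ^ 32))
      (outerPrimes v) (innerPrimes v) := by
  filter_upwards [eventually_growth] with v hv
  obtain ⟨hv, hE⟩ := hv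
  have hv0 : 0 < v := by linarith
  refine ⟨fun p hp => ?_, fun p hp => primesBetween_prime hp, fun p hp => primesBetween_prime hp,
    fun q hq => ?_, ?_, Real.one_le_exp (by positivity), Real.one_le_exp (by positivity), ?_, ?_⟩
  · exact ((mem_primesBetween (Real.exp_pos _).le).1 hp).2.1.le
  · have := (mem_primesBetween (Real.exp_pos _).le).1 hq
    exact ⟨this.2.1.le, this.2.2⟩
  · refine le_trans ?_ (Nat.floor_le (Real.exp_pos (v ^ 32)).le)
    exact_mod_cast card_primesBetween_le _ _
  · rw [← Real.exp_nat_mul, Real.exp_le_exp]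
    have := pow_mul_le_pow hv (m := 32) (n := 40) (by norm_num)
    have : 0 < v ^ 32 := by positivity
    push_cast
    linarith
  · have h1 : (modulusBound v : ℝ) ≤ Real.exp (Real.exp (v ^ 8) / v ^ 2) :=
      Nat.floor_le (by positivity)
    have h3 : (3 : ℝ) ≤ Real.exp 2 := by have := Real.add_one_le_exp (2 : ℝ); linarith
    calc 3 * (modulusBound v : ℝ) ^ 2 * Real.exp (v ^ 32) ^ 2
        ≤ Real.exp 2 * Real.exp (Real.exp (v ^ 8) / v ^ 2) ^ 2 * Real.exp (v ^ 32) ^ 2 := by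
          gcongr
      _ = Real.exp (2 + 2 * (Real.exp (v ^ 8) / v ^ 2) + 2 * v ^ 32) := by
          rw [← Real.exp_nat_mul, ← Real.exp_nat_mul, ← Real.exp_add, ← Real.exp_add]
          norm_num
      _ ≤ _ := by
          rw [Real.exp_le_exp]
          set E := Real.exp (v ^ 8)
          have h4 : E / v ^ 2 ≤ E / v / 1000 := by
            rw [div_div]
            gcongr
            nlinarith
          have h5 : v ^ 99 ≤ E / v := by
            rw [le_div_iff₀ hv0]
            calc v ^ 99 * v = v ^ 100 := by ring
              _ ≤ E := hE
          have h6 := pow_mul_le_pow hv (m := 32) (n := 99) (by norm_num)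
          have h7 : 1 ≤ v ^ 32 := one_le_pow₀ (by linarith)
          linarith

lemma eventually_card_le :
    ∀ᶠ v : ℝ in atTop, (outerPrimes v).card ≤ cutoff v
      ∧ ∀ p ∈ outerPrimes v, (innerPrimes v).card ≤ cutoff v / p := by
  filter_upwards [eventually_growth] with v hv
  obtain ⟨hv, hE⟩ := hv
  have hE0 := Real.exp_pos (v ^ 8)
  refine ⟨(card_primesBetween_le _ _).trans (Nat.floor_le_floor (Real.exp_le_exp.2 ?_)),
    fun p hp => ?_⟩
  · linarith
  · rw [Nat.le_div_iff_mul_le (primesBetween_prime hp).pos]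
    apply Nat.le_floor
    have h1 : ((innerPrimes v).card : ℝ) ≤ Real.exp (v ^ 32) := by
      refine le_trans ?_ (Nat.floor_le (Real.exp_pos (v ^ 32)).le)
      exact_mod_cast card_primesBetween_le _ _
    have h2 := ((mem_primesBetween (Real.exp_pos _).le).1 hp).2.2
    push_cast
    calc ((innerPrimes v).card : ℝ) * p
        ≤ Real.exp (v ^ 32) * Real.exp (Real.exp (v ^ 8) / 4) := by gcongr
      _ ≤ _ := by
        rw [← Real.exp_add, Real.exp_le_exp]
        have := pow_mul_le_pow hv (m := 32) (n := 100) (by norm_num)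
        have : 0 < v ^ 32 := by positivity
        linarith

lemma prod_le_of_card_le {S : Finset ℕ} {z : ℝ} (hz : 1 ≤ z) (hS : ∀ p ∈ S, (p : ℝ) ≤ z)
    {U : Finset ℕ} (hU : U ⊆ S) {K : ℕ} (hK : U.card ≤ K) :
    ((∏ p ∈ U, p : ℕ) : ℝ) ≤ z ^ K := by
  push_cast
  calc ∏ p ∈ U, (p : ℝ) ≤ ∏ p ∈ U, z :=
        Finset.prod_le_prod (fun _ _ => Nat.cast_nonneg _) fun p hp => hS p (hU hp)
    _ = z ^ U.card := by rw [Finset.prod_const]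
    _ ≤ z ^ K := pow_le_pow_right₀ hz hK

lemma eventually_prod_mainPrimes_le :
    ∀ᶠ v : ℝ in atTop, ∀ U ⊆ mainPrimes v, U.card ≤ ⌈v ^ 8⌉₊ → ∏ p ∈ U, p ≤ modulusBound v := by
  filter_upwards [eventually_growth] with v hv U hU hK
  obtain ⟨hv, hE⟩ := hv
  apply Nat.le_floor
  refine (prod_le_of_card_le (Real.one_le_exp (by positivity))
    (fun p hp => ((mem_primesBetween (Real.exp_pos _).le).1 hp).2.2) hU hK).trans ?_
  rw [← Real.exp_nat_mul, Real.exp_le_exp]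
  have h1 : (⌈v ^ 8⌉₊ : ℝ) ≤ v ^ 8 + 1 := (Nat.ceil_lt_add_one (by positivity)).le
  have h2 : v ^ 8 + 1 ≤ v ^ 22 := by
    have := pow_mul_le_pow hv (m := 8) (n := 22) (by norm_num)
    have : 1 ≤ v ^ 8 := one_le_pow₀ (by linarith)
    linarith
  have hv0 : v ≠ 0 := by linarith
  calc (⌈v ^ 8⌉₊ : ℝ) * (Real.exp (v ^ 8) / v ^ 24)
      ≤ v ^ 22 * (Real.exp (v ^ 8) / v ^ 24) := by gcongr; linarith
    _ = _ := by field_simp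

lemma lt_of_mem_mainPrimes {v : ℝ} {p : ℕ} (hp : p ∈ mainPrimes v) : Real.exp (v ^ 40) < p :=
  ((mem_primesBetween (Real.exp_pos _).le).1 hp).2.1

lemma lt_of_mem_largePrimes {v : ℝ} (hv : 1000 ≤ v) (hE : v ^ 100 ≤ Real.exp (v ^ 8)) {p : ℕ}
    (hp : p ∈ largePrimes v) : Real.exp (v ^ 40) < p := by
  refine lt_of_le_of_lt ?_ ((mem_primesBetween (Real.exp_pos _).le).1 hp).2.1
  rw [Real.exp_le_exp, le_div_iff₀ (by positivity), ← pow_add]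
  exact (pow_le_pow_right₀ (by linarith) (by norm_num)).trans hE

lemma le_of_mem_largePrimes {v : ℝ} {p : ℕ} (hp : p ∈ largePrimes v) : p ≤ modulusBound v :=
  Nat.le_floor ((mem_primesBetween (Real.exp_pos _).le).1 hp).2.2

lemma norm_prod_sub_prod_le {ι : Type*} (S : Finset ι) {f g : ι → ℂ}
    (hf : ∀ i ∈ S, ‖f i‖ ≤ 1) (hg : ∀ i ∈ S, ‖g i‖ ≤ 1) :
    ‖∏ i ∈ S, f i - ∏ i ∈ S, g i‖ ≤ ∑ i ∈ S, ‖f i - g i‖ := by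
  classical
  induction S using Finset.induction_on with
  | empty => simp
  | insert a S ha ih =>
    rw [Finset.prod_insert ha, Finset.prod_insert ha, Finset.sum_insert ha]
    have h1 := ih (fun i hi => hf i (Finset.mem_insert_of_mem hi))
      (fun i hi => hg i (Finset.mem_insert_of_mem hi))
    have h2 : ‖∏ i ∈ S, f i‖ ≤ 1 := by
      rw [norm_prod]
      exact Finset.prod_le_one (fun _ _ => norm_nonneg _)
        (fun i hi => hf i (Finset.mem_insert_of_mem hi))
    have h3 := hg a (Finset.mem_insert_self a S)
    calc ‖f a * ∏ i ∈ S, f i - g a * ∏ i ∈ S, g i‖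
        = ‖(f a - g a) * ∏ i ∈ S, f i + g a * (∏ i ∈ S, f i - ∏ i ∈ S, g i)‖ := by
          congr 1; ring
      _ ≤ ‖f a - g a‖ * ‖∏ i ∈ S, f i‖ + ‖g a‖ * ‖∏ i ∈ S, f i - ∏ i ∈ S, g i‖ := by
          rw [← norm_mul, ← norm_mul]; exact norm_add_le _ _
      _ ≤ ‖f a - g a‖ * 1 + 1 * ∑ i ∈ S, ‖f i - g i‖ := by gcongr
      _ = _ := by ring

lemma norm_prod_one_add_div_sub_exp_le {R : ℝ} (hR0 : 0 < R) {S : Finset ℕ}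
    (hS : ∀ p ∈ S, p.Prime) (hR : ∀ p ∈ S, R < p) {y : ℂ} (hy1 : ‖1 + y‖ ≤ 1) (hy : ‖y‖ ≤ 1) :
    ‖∏ p ∈ S, (1 + y / p) - Complex.exp (y * (∑ p ∈ S, (1 : ℝ) / p : ℝ))‖
      ≤ (∑ p ∈ S, (1 : ℝ) / p) / R := by
  have hre : y.re ≤ 0 := by
    have := (Complex.re_le_norm (1 + y)).trans hy1
    rw [Complex.add_re, Complex.one_re] at this
    linarith
  have hexp : Complex.exp (y * (∑ p ∈ S, (1 : ℝ) / p : ℝ)) = ∏ p ∈ S, Complex.exp (y / p) := by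
    rw [← Complex.exp_sum]
    congr 1
    push_cast
    rw [Finset.mul_sum]
    exact Finset.sum_congr rfl fun p _ => by ring
  rw [hexp]
  refine (norm_prod_sub_prod_le S (fun p hp => norm_one_add_div_le hy1 (hS p hp).one_le)
    (fun p hp => ?_)).trans ?_
  · rw [Complex.norm_exp, Real.exp_le_one_iff, Complex.div_natCast_re]
    exact div_nonpos_of_nonpos_of_nonneg hre (Nat.cast_nonneg _)
  · rw [Finset.sum_div]
    refine Finset.sum_le_sum fun p hp => ?_
    have hp1 : (1 : ℝ) ≤ p := by exact_mod_cast (hS p hp).one_le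
    have hyp : ‖y / p‖ ≤ 1 / p := by
      rw [norm_div, Complex.norm_natCast]
      gcongr
    have h := Complex.norm_exp_sub_one_sub_id_le (x := y / p)
      (hyp.trans (div_le_one_of_le₀ hp1 (by linarith)))
    rw [norm_sub_rev]
    calc ‖Complex.exp (y / p) - (1 + y / p)‖ = ‖Complex.exp (y / p) - 1 - y / p‖ := by
          congr 1; ring
      _ ≤ ‖y / p‖ ^ 2 := h
      _ ≤ (1 / (p : ℝ)) ^ 2 := by gcongr
      _ = 1 / p / p := by ring
      _ ≤ 1 / p / R := by
          have := hR p hp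
          gcongr

/-- The phase increment `exp (i t / v ^ 4) - 1`. -/
noncomputable def phase (t v : ℝ) : ℂ := Complex.exp (Complex.I * (t / v ^ 4 : ℝ)) - 1

lemma norm_one_add_phase (t v : ℝ) : ‖1 + phase t v‖ = 1 := by
  rw [phase, add_sub_cancel, mul_comm, Complex.norm_exp_ofReal_mul_I]

lemma norm_phase_le {v : ℝ} (t : ℝ) (hv : 0 < v) : ‖phase t v‖ ≤ |t| / v ^ 4 := by
  refine (Real.norm_exp_I_mul_ofReal_sub_one_le).trans ?_
  rw [Real.norm_eq_abs, abs_div, abs_of_pos (show 0 < v ^ 4 by positivity)]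

lemma norm_phase_sub_le {v t : ℝ} (hv : 0 < v) (ht : |t| ≤ v ^ 4) :
    ‖phase t v - Complex.I * (t / v ^ 4 : ℝ) + ((t / v ^ 4 : ℝ) : ℂ) ^ 2 / 2‖
      ≤ (|t| / v ^ 4) ^ 3 := by
  have hn : ‖Complex.I * ((t / v ^ 4 : ℝ) : ℂ)‖ = |t| / v ^ 4 := by
    rw [norm_mul, Complex.norm_I, one_mul, Complex.norm_real, Real.norm_eq_abs, abs_div,
      abs_of_pos (show 0 < v ^ 4 by positivity)]
  have h := Complex.exp_bound (x := Complex.I * ((t / v ^ 4 : ℝ) : ℂ))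
    (by rw [hn]; exact div_le_one_of_le₀ ht (by positivity)) (n := 3) (by norm_num)
  rw [hn] at h
  have h2 : phase t v - Complex.I * (t / v ^ 4 : ℝ) + ((t / v ^ 4 : ℝ) : ℂ) ^ 2 / 2
      = Complex.exp (Complex.I * ((t / v ^ 4 : ℝ) : ℂ))
        - ∑ m ∈ Finset.range 3, (Complex.I * ((t / v ^ 4 : ℝ) : ℂ)) ^ m / (m.factorial : ℂ) := by
    simp only [Finset.sum_range_succ, Finset.sum_range_zero, mul_pow, Complex.I_sq, phase]
    norm_num [Nat.factorial]
    ring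
  rw [h2]
  refine h.trans (mul_le_of_le_one_right (by positivity) ?_)
  norm_num [Nat.factorial]

lemma tendsto_phase_mul_sum_sub (t : ℝ) :
    Tendsto (fun v : ℝ => phase t v * (∑ p ∈ mainPrimes v, (1 : ℝ) / p : ℝ)
      - Complex.I * (t * v ^ 4 : ℝ)) atTop (nhds (-(t : ℂ) ^ 2 / 2)) := by
  rw [tendsto_iff_norm_sub_tendsto_zero]
  have hlim : Tendsto (fun v : ℝ => (69 * |t| + |t| ^ 3) / v) atTop (nhds 0) :=
    tendsto_const_nhds.div_atTop tendsto_id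
  refine squeeze_zero' (Eventually.of_forall fun _ => norm_nonneg _) ?_ hlim
  filter_upwards [eventually_growth, eventually_ge_atTop |t|] with v hv ht
  obtain ⟨hv, hE⟩ := hv
  have hv0 : 0 < v := by linarith
  have hs := abs_sum_inv_mainPrimes_sub_le hv hE
  set s := ∑ p ∈ mainPrimes v, (1 : ℝ) / p
  have hs' : |s - v ^ 8| ≤ 69 * v := by
    have h1 := Real.log_le_self hv0.le
    have h2 := Real.log_nonneg (show 1 ≤ v by linarith)
    rw [abs_le] at hs ⊢
    constructor <;> linarith
  have hvc : (v : ℂ) ≠ 0 := by exact_mod_cast hv0.ne'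
  have hdec : phase t v * (s : ℂ) - Complex.I * (t * v ^ 4 : ℝ) - -(t : ℂ) ^ 2 / 2
      = phase t v * ((s - v ^ 8 : ℝ) : ℂ) + ((v ^ 8 : ℝ) : ℂ)
        * (phase t v - Complex.I * (t / v ^ 4 : ℝ) + ((t / v ^ 4 : ℝ) : ℂ) ^ 2 / 2) := by
    push_cast
    field_simp
    ring
  rw [hdec]
  have ht4 : |t| ≤ v ^ 4 := ht.trans (le_self_pow₀ (by linarith) (by norm_num))
  calc _ ≤ ‖phase t v‖ * |s - v ^ 8| + v ^ 8
        * ‖phase t v - Complex.I * (t / v ^ 4 : ℝ) + ((t / v ^ 4 : ℝ) : ℂ) ^ 2 / 2‖ := by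
        refine (norm_add_le _ _).trans (le_of_eq ?_)
        rw [norm_mul, norm_mul, Complex.norm_real, Complex.norm_real, Real.norm_eq_abs,
          Real.norm_of_nonneg (by positivity)]
    _ ≤ |t| / v ^ 4 * (69 * v) + v ^ 8 * (|t| / v ^ 4) ^ 3 := by
        gcongr
        · exact norm_phase_le t hv0
        · exact norm_phase_sub_le hv0 ht4
    _ = 69 * |t| / v ^ 3 + |t| ^ 3 / v ^ 4 := by field_simp
    _ ≤ 69 * |t| / v + |t| ^ 3 / v := by
        gcongr <;> exact le_self_pow₀ (by linarith) (by norm_num)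
    _ = _ := by ring

lemma tendsto_prod_mainPrimes (t : ℝ) :
    Tendsto (fun v : ℝ => Complex.exp (-(Complex.I * (t * v ^ 4 : ℝ)))
      * ∏ p ∈ mainPrimes v, (1 + phase t v / p)) atTop (nhds (Complex.exp (-(t : ℂ) ^ 2 / 2))) := by
  have h1 := (Complex.continuous_exp.tendsto _).comp (tendsto_phase_mul_sum_sub t)
  refine tendsto_of_tendsto_of_dist h1 ?_
  have hlim : Tendsto (fun v : ℝ => 1 / v) atTop (nhds 0) :=
    tendsto_const_nhds.div_atTop tendsto_id
  refine squeeze_zero' (Eventually.of_forall fun _ => dist_nonneg) ?_ hlim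
  filter_upwards [eventually_growth, eventually_ge_atTop |t|] with v hv ht
  obtain ⟨hv, hE⟩ := hv
  have hv0 : 0 < v := by linarith
  have hs := abs_sum_inv_mainPrimes_sub_le hv hE
  have ht4 : |t| ≤ v ^ 4 := ht.trans (le_self_pow₀ (by linarith) (by norm_num))
  have h2 := norm_prod_one_add_div_sub_exp_le (Real.exp_pos (v ^ 40)) (S := mainPrimes v)
    (fun p hp => primesBetween_prime hp) (fun p hp => lt_of_mem_mainPrimes hp)
    (norm_one_add_phase t v).le
    ((norm_phase_le t hv0).trans (div_le_one_of_le₀ ht4 (by positivity)))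
  set s := ∑ p ∈ mainPrimes v, (1 : ℝ) / p
  have hs' : s ≤ v ^ 9 := by
    have h2 := Real.log_nonneg (show 1 ≤ v by linarith)
    have h3 := pow_mul_le_pow hv (m := 8) (n := 9) (by norm_num)
    have h4 : 1 ≤ v ^ 8 := one_le_pow₀ (by linarith)
    linarith [(abs_le.1 hs).2]
  have hexp : v ^ 10 ≤ Real.exp (v ^ 40) := by
    have h5 := Real.add_one_le_exp (v ^ 40)
    have h6 := pow_mul_le_pow hv (m := 10) (n := 40) (by norm_num)
    have h7 : 0 < v ^ 10 := by positivity
    linarith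
  rw [dist_comm, dist_eq_norm, Function.comp_apply, sub_eq_neg_add (phase t v * _), Complex.exp_add,
    ← mul_sub, norm_mul]
  have h8 : ‖Complex.exp (-(Complex.I * (t * v ^ 4 : ℝ)))‖ = 1 := by
    have : -(Complex.I * (t * v ^ 4 : ℝ)) = ((-(t * v ^ 4) : ℝ) : ℂ) * Complex.I := by
      push_cast; ring
    rw [this, Complex.norm_exp_ofReal_mul_I]
  rw [h8, one_mul]
  refine h2.trans ?_
  calc s / Real.exp (v ^ 40) ≤ v ^ 9 / v ^ 10 := by gcongr
    _ = 1 / v := by field_simp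

lemma tendsto_productTail_mainPrimes (t : ℝ) :
    Tendsto (fun v : ℝ => productTail (mainPrimes v) ⌈v ^ 8⌉₊ ‖phase t v‖) atTop (nhds 0) := by
  refine squeeze_zero' (Eventually.of_forall fun _ => productTail_nonneg _ _ (norm_nonneg _)) ?_
    (Real.tendsto_exp_neg_atTop_nhds_zero)
  filter_upwards [eventually_growth, eventually_ge_atTop |t|] with v hv ht
  obtain ⟨hv, hE⟩ := hv
  have hv0 : 0 < v := by linarith
  refine (productTail_le _ _ (norm_nonneg _)).trans (Real.exp_le_exp.2 ?_)
  have hs := (abs_le.1 (abs_sum_inv_mainPrimes_sub_le hv hE)).2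
  set s := ∑ p ∈ mainPrimes v, (1 : ℝ) / p
  have hs0 : 0 ≤ s := Finset.sum_nonneg fun _ _ => by positivity
  have hs' : s ≤ 2 * v ^ 8 := by
    have h2 := Real.log_nonneg (show 1 ≤ v by linarith)
    have h4 : v ≤ v ^ 8 := le_self_pow₀ (by linarith) (by norm_num)
    linarith
  have he : Real.exp 1 ≤ 3 := Real.exp_one_lt_three.le
  have h1 : Real.exp 1 * ‖phase t v‖ * s ≤ 3 * (v / v ^ 4) * (2 * v ^ 8) := by
    gcongr
    exact (norm_phase_le t hv0).trans (by gcongr)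
  have h2 : 3 * (v / v ^ 4) * (2 * v ^ 8) = 6 * v ^ 5 := by field_simp; norm_num
  have h3 := Nat.le_ceil (v ^ 8)
  have h4 := pow_mul_le_pow hv (m := 5) (n := 8) (by norm_num)
  have h5 : v ≤ v ^ 5 := le_self_pow₀ (by linarith) (by norm_num)
  linarith

lemma cutoff_pos {v : ℝ} : 0 < cutoff v := by
  apply Nat.floor_pos.2
  exact Real.one_le_exp (Real.exp_pos _).le

lemma tendsto_charFun_mainPrimes (t : ℝ) :
    Tendsto (fun v : ℝ => (cutoff v : ℂ)⁻¹ * ∑ n ∈ Finset.Icc 1 (cutoff v),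
      Complex.exp (((t * (((divCount (mainPrimes v) (sopfr n) : ℝ) - v ^ 8) / v ^ 4) : ℝ) : ℂ)
        * Complex.I)) atTop (nhds (Complex.exp (-(t : ℂ) ^ 2 / 2))) := by
  refine tendsto_of_tendsto_of_dist (tendsto_prod_mainPrimes t) ?_
  have hlim : Tendsto (fun v : ℝ => 2 * averagingError (outerPrimes v) (innerPrimes v)
      + 2 * productTail (mainPrimes v) ⌈v ^ 8⌉₊ ‖phase t v‖ + 30 * Real.exp (-v)) atTop
      (nhds (2 * 0 + 2 * 0 + 30 * 0)) :=
    ((tendsto_averagingError.const_mul 2).add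
      ((tendsto_productTail_mainPrimes t).const_mul 2)).add
      (Real.tendsto_exp_neg_atTop_nhds_zero.const_mul 30)
  norm_num only at hlim
  refine squeeze_zero' (Eventually.of_forall fun _ => dist_nonneg) ?_ hlim
  filter_upwards [eventually_growth, eventually_ge_atTop |t|, eventually_averagingData,
    eventually_prod_mainPrimes_le, eventually_card_le, eventually_one_le_sum_inv,
    eventually_averagingBound_le] with v hv ht hdata hprod hcard hsum hbound
  obtain ⟨hv, hE⟩ := hv
  have hv0 : 0 < v := by linarith
  have ht4 : |t| ≤ v ^ 4 := ht.trans (le_self_pow₀ (by linarith) (by norm_num))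
  have hmain := norm_sum_pow_divCount_sopfr_le hdata (S := mainPrimes v)
    (fun p hp => primesBetween_prime hp) (fun p hp => lt_of_mem_mainPrimes hp) hprod
    (norm_one_add_phase t v).le
    ((norm_phase_le t hv0).trans (div_le_one_of_le₀ ht4 (by positivity)))
    (cutoff v) hcard.1 hcard.2 hsum.1 hsum.2
  have hN : (0 : ℝ) < cutoff v := by exact_mod_cast cutoff_pos
  have hNc : (cutoff v : ℂ) ≠ 0 := by exact_mod_cast (cutoff_pos (v := v)).ne'
  have hvc : (v : ℂ) ≠ 0 := by exact_mod_cast hv0.ne'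
  have hterm : ∀ n, Complex.exp (((t * (((divCount (mainPrimes v) (sopfr n) : ℝ) - v ^ 8) / v ^ 4)
        : ℝ) : ℂ) * Complex.I) = Complex.exp (-(Complex.I * (t * v ^ 4 : ℝ)))
        * (1 + phase t v) ^ divCount (mainPrimes v) (sopfr n) := by
    intro n
    rw [phase, add_sub_cancel, ← Complex.exp_nat_mul, ← Complex.exp_add]
    congr 1
    push_cast
    field_simp
    ring
  have h8 : ‖Complex.exp (-(Complex.I * (t * v ^ 4 : ℝ)))‖ = 1 := by
    have : -(Complex.I * (t * v ^ 4 : ℝ)) = ((-(t * v ^ 4) : ℝ) : ℂ) * Complex.I := by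
      push_cast; ring
    rw [this, Complex.norm_exp_ofReal_mul_I]
  rw [dist_comm, dist_eq_norm, Finset.sum_congr rfl fun n _ => hterm n, ← Finset.mul_sum]
  set c := Complex.exp (-(Complex.I * (t * v ^ 4 : ℝ)))
  set A := ∑ n ∈ Finset.Icc 1 (cutoff v), (1 + phase t v) ^ divCount (mainPrimes v) (sopfr n)
  set B := ∏ p ∈ mainPrimes v, (1 + phase t v / p)
  have hdec : (cutoff v : ℂ)⁻¹ * (c * A) - c * B = c * ((cutoff v : ℂ)⁻¹ * (A - cutoff v * B)) := by
    field_simp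
  rw [hdec, norm_mul, h8, one_mul, norm_mul, norm_inv, Complex.norm_natCast,
    inv_mul_le_iff₀ hN]
  refine hmain.trans ?_
  nlinarith [hbound]

lemma tendsto_card_filter_largePrimes :
    Tendsto (fun v : ℝ => (((Finset.Icc 1 (cutoff v)).filter fun n =>
      v ^ 2 ≤ divCount (largePrimes v) (sopfr n)).card : ℝ) / cutoff v) atTop (nhds 0) := by
  have hlim : Tendsto (fun v : ℝ => averagingError (outerPrimes v) (innerPrimes v) + 37 / v) atTop
      (nhds (0 + 0)) := tendsto_averagingError.add (tendsto_const_nhds.div_atTop tendsto_id)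
  rw [add_zero] at hlim
  refine squeeze_zero' (Eventually.of_forall fun _ => by positivity) ?_ hlim
  filter_upwards [eventually_growth, eventually_averagingData, eventually_card_le,
    eventually_one_le_sum_inv, eventually_averagingBound_le] with v hv hdata hcard hsum hbound
  obtain ⟨hv, hE⟩ := hv
  have hv0 : 0 < v := by linarith
  have hN : (0 : ℝ) < cutoff v := by exact_mod_cast cutoff_pos
  have h := card_filter_divCount_sopfr_le hdata (S := largePrimes v)
    (fun p hp => primesBetween_prime hp) (fun p hp => lt_of_mem_largePrimes hv hE hp)
    (fun p hp => le_of_mem_largePrimes hp) (cutoff v) hcard.1 hcard.2 hsum.1 hsum.2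
    (V := v ^ 2) (by positivity)
  rw [div_le_iff₀ hN]
  refine h.trans ?_
  have hs := (abs_le.1 (abs_sum_inv_largePrimes_sub_le hv hE)).2
  have hlog := Real.log_le_self hv0.le
  have hexp : Real.exp (-v) ≤ 1 := Real.exp_le_one_iff.2 (by linarith)
  have h1 : ((cutoff v : ℝ) * (∑ r ∈ largePrimes v, (1 : ℝ) / r)
      + averagingBound (cutoff v) (modulusBound v) (Real.exp (v ^ 24)) (innerPrimes v)) / v ^ 2
      ≤ (cutoff v * (37 * v)) / v ^ 2 := by
    gcongr
    calc _ ≤ (cutoff v : ℝ) * (22 * v + 5) + cutoff v * (10 * Real.exp (-v)) := by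
          gcongr
          linarith
      _ = cutoff v * (22 * v + 5 + 10 * Real.exp (-v)) := by ring
      _ ≤ cutoff v * (37 * v) := by gcongr; linarith
  have h2 : ((cutoff v : ℝ) * (37 * v)) / v ^ 2 = cutoff v * (37 / v) := by field_simp
  linarith

lemma tendsto_card_filter_smallPrimes :
    Tendsto (fun v : ℝ => (((Finset.Icc 1 (cutoff v)).filter fun n =>
      v ^ 2 ≤ divCount (smallPrimes v) (sopfr n)).card : ℝ) / cutoff v) atTop (nhds 0) := by
  have h1 : Tendsto (fun v : ℝ => √(3 / (Real.log v - 5))) atTop (nhds 0) := by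
    have := (tendsto_const_nhds (x := (3 : ℝ))).div_atTop
      (tendsto_atTop_add_const_right _ (-5) Real.tendsto_log_atTop)
    have := (Real.continuous_sqrt.tendsto 0).comp this
    rwa [Real.sqrt_zero] at this
  have hlim := h1.add (Real.tendsto_exp_neg_atTop_nhds_zero.const_mul 4)
  rw [mul_zero, add_zero] at hlim
  refine squeeze_zero' (Eventually.of_forall fun _ => by positivity) ?_ hlim
  filter_upwards [eventually_growth, Real.tendsto_log_atTop.eventually_ge_atTop 6] with v hv hl
  obtain ⟨hv, hE⟩ := hv
  have hv0 : 0 < v := by linarith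
  have hN : (0 : ℝ) < cutoff v := by exact_mod_cast cutoff_pos
  have hQ := (abs_le.1 (abs_sum_inv_primesBetween_exp_sub_le (a := v ^ 43) (b := v ^ 44)
    (one_le_pow₀ (by linarith)) (pow_le_pow_right₀ (by linarith) (by norm_num)))).1
  rw [Real.log_pow, Real.log_pow] at hQ
  push_cast at hQ
  have hk1 : (⌈v ^ 2⌉₊ : ℝ) ≤ v ^ 2 + 1 := (Nat.ceil_lt_add_one (by positivity)).le
  have h := card_filter_small_divCount_sopfr_le (S := smallPrimes v)
    (Q := primesBetween (Real.exp (v ^ 43)) (Real.exp (v ^ 44))) (k := ⌈v ^ 2⌉₊)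
    (q₀ := ⌊Real.exp (v ^ 43)⌋₊) (q₁ := ⌊Real.exp (v ^ 44)⌋₊)
    (fun p hp => primesBetween_prime hp) (fun p hp => primesBetween_prime hp)
    (fun q hq => by
      have hq := (mem_primesBetween (Real.exp_pos _).le).1 hq
      exact ⟨Nat.floor_le_of_le hq.2.1.le, Nat.le_floor hq.2.2⟩)
    (fun U hU hk => by
      apply Nat.le_floor
      refine (prod_le_of_card_le (Real.one_le_exp (by positivity))
        (fun p hp => ((mem_primesBetween le_rfl).1 hp).2.2) hU hk.le).trans ?_
      rw [← Real.exp_nat_mul, Real.exp_le_exp]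
      have h42 := pow_mul_le_pow hv (m := 42) (n := 43) (by norm_num)
      have h40 := pow_mul_le_pow hv (m := 40) (n := 42) (by norm_num)
      have : 0 < v ^ 40 := by positivity
      calc (⌈v ^ 2⌉₊ : ℝ) * v ^ 40 ≤ (v ^ 2 + 1) * v ^ 40 := by gcongr
        _ = v ^ 42 + v ^ 40 := by ring
        _ ≤ v ^ 43 := by linarith)
    (cutoff v)
    ((card_primesBetween_le _ _).trans (Nat.floor_le_floor (Real.exp_le_exp.2
      ((pow_le_pow_right₀ (by linarith) (by norm_num)).trans hE))))
    (by linarith)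
  simp only [Nat.ceil_le] at h
  rw [div_le_iff₀' hN]
  refine h.trans (mul_le_mul_of_nonneg_left (add_le_add ?_ ?_) hN.le)
  · apply Real.sqrt_le_sqrt
    gcongr <;> linarith
  · have ht := productTail_le (smallPrimes v) ⌈v ^ 2⌉₊ zero_le_one
    have hs := sum_inv_smallPrimes_le hv
    have hs0 : 0 ≤ ∑ p ∈ smallPrimes v, (1 : ℝ) / p := Finset.sum_nonneg fun _ _ => by positivity
    have hlog := Real.log_le_self hv0.le
    have ht2 : productTail (smallPrimes v) ⌈v ^ 2⌉₊ 1 ≤ Real.exp (-(45 * v)) := by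
      refine ht.trans (Real.exp_le_exp.2 ?_)
      have h3 : Real.exp 1 * 1 * ∑ p ∈ smallPrimes v, (1 : ℝ) / p ≤ 3 * 1 * (40 * v + 4) := by
        gcongr
        · exact Real.exp_one_lt_three.le
        · linarith
      have h4 := Nat.le_ceil (v ^ 2)
      nlinarith
    have hlogq : Real.log ⌊Real.exp (v ^ 44)⌋₊ ≤ v ^ 44 := log_natFloor_exp_le _ (by positivity)
    have hlogq0 : 0 ≤ Real.log ⌊Real.exp (v ^ 44)⌋₊ := Real.log_natCast_nonneg _
    have hve : v ^ 44 ≤ Real.exp (44 * v) := by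
      have : v ≤ Real.exp v := by have := Real.add_one_le_exp v; linarith
      calc v ^ 44 ≤ Real.exp v ^ 44 := by gcongr
        _ = _ := by rw [← Real.exp_nat_mul]; norm_num
    have h1e : 1 ≤ Real.exp (44 * v) := Real.one_le_exp (by positivity)
    have htn := productTail_nonneg (smallPrimes v) ⌈v ^ 2⌉₊ zero_le_one
    calc _ ≤ (Real.exp (44 * v) + Real.exp (44 * v)) * (2 * Real.exp (-(45 * v))) := by
          gcongr
          exact hlogq.trans hve
      _ = 4 * (Real.exp (44 * v) * Real.exp (-(45 * v))) := by ring
      _ = 4 * Real.exp (-v) := by rw [← Real.exp_add]; ring_nf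

lemma divCount_mainPrimes_le {v : ℝ} {a : ℕ} (ha : a ≠ 0) :
    divCount (mainPrimes v) a ≤ a.primeFactors.card :=
  divCount_le_card_primeFactors (fun _ hp => primesBetween_prime hp) ha

/-- Outside a negligible set of `n`, the prime factors of `sopfr n` outside the main range number
at most `3 v ^ 2`. -/
lemma tendsto_card_filter_exceptional :
    Tendsto (fun v : ℝ => (((Finset.Icc 1 (cutoff v)).filter fun n =>
      (divCount (mainPrimes v) (sopfr n) : ℝ) + 3 * v ^ 2 < (sopfr n).primeFactors.card).card : ℝ)
        / cutoff v) atTop (nhds 0) := by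
  have hlim := tendsto_card_filter_largePrimes.add tendsto_card_filter_smallPrimes
  rw [add_zero] at hlim
  refine squeeze_zero' (Eventually.of_forall fun _ => by positivity) ?_ hlim
  filter_upwards [eventually_growth] with v hv
  have hv0 : 0 < v := by linarith [hv.1]
  rw [← add_div]
  gcongr
  norm_cast
  rw [add_comm]
  refine (Finset.card_le_card fun n hn => ?_).trans (Finset.card_union_le _ _)
  rw [Finset.mem_filter] at hn
  obtain ⟨hn, hlt⟩ := hn
  rw [Finset.mem_union, Finset.mem_filter, Finset.mem_filter]
  by_contra! hcon
  have hsm := hcon.1 hn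
  have hla := hcon.2 hn
  have hdec := card_primeFactors_le_divCount (R := Real.exp (v ^ 40))
    (z := Real.exp (Real.exp (v ^ 8) / v ^ 24)) (w := Real.exp (Real.exp (v ^ 8) / v ^ 2))
    (Real.exp_pos _).le (Real.exp_pos _).le (sopfr n)
  have hbig : (((sopfr n).primeFactors.filter fun p : ℕ =>
      Real.exp (Real.exp (v ^ 8) / v ^ 2) < p).card : ℝ) ≤ v ^ 2 := by
    rw [Finset.mem_Icc] at hn
    by_cases h1 : n = 1
    · subst h1
      have : sopfr 1 = 0 := by simp [sopfr]
      rw [this]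
      simp
      positivity
    have hs0 := sopfr_ne_zero (n := n) (by omega)
    have h2 := card_filter_primeFactors_mul_log_le hs0
      (w := Real.exp (Real.exp (v ^ 8) / v ^ 2)) (Real.one_le_exp (by positivity))
    rw [Real.log_exp] at h2
    have h3 : Real.log (sopfr n) ≤ Real.exp (v ^ 8) := by
      refine le_trans ?_ (log_natFloor_exp_le _ (Real.exp_pos (v ^ 8)).le)
      refine Real.log_le_log (by exact_mod_cast Nat.pos_of_ne_zero hs0) ?_
      exact_mod_cast (sopfr_le (by omega)).trans hn.2
    have h4 := h2.trans h3
    rwa [← le_div_iff₀ (by positivity), div_div_cancel₀ (Real.exp_pos _).ne'] at h4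
  have hdec' : ((sopfr n).primeFactors.card : ℝ)
      ≤ divCount (smallPrimes v) (sopfr n) + divCount (mainPrimes v) (sopfr n)
        + divCount (largePrimes v) (sopfr n) + (((sopfr n).primeFactors.filter fun p : ℕ =>
      Real.exp (Real.exp (v ^ 8) / v ^ 2) < p).card : ℝ) := by exact_mod_cast hdec
  linarith

/-- The standard Gaussian distribution function. -/
noncomputable def gaussianCDF (u : ℝ) : ℝ :=
  (Real.sqrt (2 * Real.pi))⁻¹ * ∫ t in Set.Iic u, Real.exp (-t ^ 2 / 2)

lemma integrable_exp_neg_sq_div_two : MeasureTheory.Integrable fun t : ℝ => Real.exp (-t ^ 2 / 2) := by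
  refine (integrable_exp_neg_mul_sq (b := 1 / 2) (by norm_num)).congr (Eventually.of_forall ?_)
  intro t
  ring_nf

lemma continuous_gaussianCDF : Continuous gaussianCDF := by
  have h : gaussianCDF = fun u => (Real.sqrt (2 * Real.pi))⁻¹ *
      ((∫ t in Set.Iic 0, Real.exp (-t ^ 2 / 2)) + ∫ t in (0 : ℝ)..u, Real.exp (-t ^ 2 / 2)) := by
    ext u
    rw [gaussianCDF, ← intervalIntegral.integral_Iic_sub_Iic
      integrable_exp_neg_sq_div_two.integrableOn integrable_exp_neg_sq_div_two.integrableOn]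
    ring
  rw [h]
  exact continuous_const.mul (continuous_const.add (intervalIntegral.continuous_primitive
    (fun _ _ => integrable_exp_neg_sq_div_two.intervalIntegrable) 0))

lemma gaussianReal_Iic (u : ℝ) :
    ((ProbabilityTheory.gaussianReal 0 1) (Set.Iic u)).toReal = gaussianCDF u := by
  rw [ProbabilityTheory.gaussianReal_apply_eq_integral 0 one_ne_zero, ENNReal.toReal_ofReal,
    gaussianCDF, ← MeasureTheory.integral_const_mul]
  · simp [ProbabilityTheory.gaussianPDFReal]
  · exact MeasureTheory.integral_nonneg fun _ => ProbabilityTheory.gaussianPDFReal_nonneg _ _ _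

/-- The law of `g n` for `n` uniform in `{1, …, N}`. -/
noncomputable def uniformLaw (N : ℕ) (g : ℕ → ℝ) : MeasureTheory.Measure ℝ :=
  ∑ n ∈ Finset.Icc 1 N, (N : ENNReal)⁻¹ • MeasureTheory.Measure.dirac (g n)

lemma uniformLaw_apply (N : ℕ) (g : ℕ → ℝ) (s : Set ℝ) [DecidablePred (g · ∈ s)]
    (hs : MeasurableSet s) :
    uniformLaw N g s = ((Finset.Icc 1 N).filter (g · ∈ s)).card * (N : ENNReal)⁻¹ := by
  classical
  rw [uniformLaw, MeasureTheory.Measure.finsetSum_apply]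
  simp only [MeasureTheory.Measure.smul_apply, smul_eq_mul,
    MeasureTheory.Measure.dirac_apply' _ hs, Set.indicator_apply, Pi.one_apply]
  rw [← Finset.mul_sum, mul_comm, Finset.sum_boole]

lemma isProbabilityMeasure_uniformLaw {N : ℕ} (hN : 0 < N) (g : ℕ → ℝ) :
    MeasureTheory.IsProbabilityMeasure (uniformLaw N g) := by
  classical
  refine ⟨?_⟩
  rw [uniformLaw_apply _ _ _ MeasurableSet.univ]
  simp only [Set.mem_univ, Finset.filter_true, Nat.card_Icc, Nat.add_sub_cancel]
  exact ENNReal.mul_inv_cancel (by exact_mod_cast hN.ne') (ENNReal.natCast_ne_top N)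

lemma charFun_uniformLaw (N : ℕ) (g : ℕ → ℝ) (t : ℝ) :
    MeasureTheory.charFun (uniformLaw N g) t
      = (N : ℂ)⁻¹ * ∑ n ∈ Finset.Icc 1 N, Complex.exp (((t * g n : ℝ) : ℂ) * Complex.I) := by
  rcases Nat.eq_zero_or_pos N with rfl | hN
  · simp [uniformLaw]
  have hN' : (N : ENNReal)⁻¹ ≠ ⊤ := ENNReal.inv_ne_top.2 (by exact_mod_cast hN.ne')
  rw [MeasureTheory.charFun_apply_real, uniformLaw, MeasureTheory.integral_finsetSum_measure]
  · rw [Finset.mul_sum]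
    refine Finset.sum_congr rfl fun n _ => ?_
    rw [MeasureTheory.integral_smul_measure, MeasureTheory.integral_dirac, ENNReal.toReal_inv,
      ENNReal.toReal_natCast, Complex.real_smul]
    push_cast
    rfl
  · intro n _
    exact (MeasureTheory.integrable_dirac (by simp)).smul_measure hN'

lemma tendsto_card_filter_le_of_tendsto_charFun {N : ℕ → ℕ} (hN : ∀ k, 0 < N k)
    {g : ℕ → ℕ → ℝ}
    (h : ∀ t : ℝ, Tendsto (fun k => (N k : ℂ)⁻¹ * ∑ n ∈ Finset.Icc 1 (N k),
      Complex.exp (((t * g k n : ℝ) : ℂ) * Complex.I)) atTop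
      (nhds (Complex.exp (-(t : ℂ) ^ 2 / 2)))) (u : ℝ) :
    Tendsto (fun k => (((Finset.Icc 1 (N k)).filter fun n => g k n ≤ u).card : ℝ) / N k) atTop
      (nhds (gaussianCDF u)) := by
  let μ : ℕ → MeasureTheory.ProbabilityMeasure ℝ := fun k =>
    ⟨uniformLaw (N k) (g k), isProbabilityMeasure_uniformLaw (hN k) (g k)⟩
  let μ₀ : MeasureTheory.ProbabilityMeasure ℝ :=
    ⟨ProbabilityTheory.gaussianReal 0 1, inferInstance⟩
  have hμ : Tendsto μ atTop (nhds μ₀) := by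
    rw [MeasureTheory.ProbabilityMeasure.tendsto_iff_tendsto_charFun]
    intro t
    have h0 : MeasureTheory.charFun (μ₀ : MeasureTheory.Measure ℝ) t
        = Complex.exp (-(t : ℂ) ^ 2 / 2) := by
      change MeasureTheory.charFun (ProbabilityTheory.gaussianReal 0 1) t = _
      rw [ProbabilityTheory.charFun_gaussianReal]
      congr 1
      push_cast
      ring
    rw [h0]
    refine (h t).congr fun k => ?_
    exact (charFun_uniformLaw _ _ _).symm
  have hfr : (μ₀ : MeasureTheory.Measure ℝ) (frontier (Set.Iic u)) = 0 := by
    rw [frontier_Iic]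
    have := ProbabilityTheory.nullSingletonClass_gaussianReal (μ := 0) (v := 1) one_ne_zero
    exact MeasureTheory.measure_singleton (μ := ProbabilityTheory.gaussianReal 0 1) u
  have h1 := MeasureTheory.ProbabilityMeasure.tendsto_measure_of_null_frontier_of_tendsto' hμ hfr
  have h2 := (ENNReal.tendsto_toReal (MeasureTheory.measure_ne_top _ _)).comp h1
  rw [show ((μ₀ : MeasureTheory.Measure ℝ) (Set.Iic u)).toReal = gaussianCDF u from
    gaussianReal_Iic u] at h2
  refine h2.congr fun k => ?_
  change (uniformLaw (N k) (g k) (Set.Iic u)).toReal = _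
  classical
  rw [uniformLaw_apply _ _ _ measurableSet_Iic, ENNReal.toReal_mul, ENNReal.toReal_inv,
    ENNReal.toReal_natCast, ENNReal.toReal_natCast, ← div_eq_mul_inv]
  simp only [Set.mem_Iic]

lemma tendsto_card_filter_mainPrimes (u : ℝ) :
    Tendsto (fun v : ℝ => (((Finset.Icc 1 (cutoff v)).filter fun n =>
      ((divCount (mainPrimes v) (sopfr n) : ℝ) - v ^ 8) / v ^ 4 ≤ u).card : ℝ) / cutoff v) atTop
      (nhds (gaussianCDF u)) := by
  refine tendsto_of_seq_tendsto fun w hw => ?_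
  exact tendsto_card_filter_le_of_tendsto_charFun (N := fun k => cutoff (w k))
    (g := fun k n => ((divCount (mainPrimes (w k)) (sopfr n) : ℝ) - w k ^ 8) / w k ^ 4)
    (fun k => cutoff_pos) (fun t => (tendsto_charFun_mainPrimes t).comp hw) u

lemma tendsto_cutoff : Tendsto (fun v : ℝ => (cutoff v : ℝ)) atTop atTop := by
  refine tendsto_natCast_atTop_atTop.comp (tendsto_nat_floor_atTop.comp ?_)
  exact Real.tendsto_exp_atTop.comp (Real.tendsto_exp_atTop.comp (tendsto_pow_atTop (by norm_num)))

lemma tendsto_card_filter_primeFactors (u : ℝ) :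
    Tendsto (fun v : ℝ => (((Finset.Icc 2 (cutoff v)).filter fun n =>
      ((sopfr n).primeFactors.card : ℝ) - v ^ 8 ≤ u * v ^ 4).card : ℝ) / cutoff v) atTop
      (nhds (gaussianCDF u)) := by
  rw [tendsto_order]
  constructor
  · intro a ha
    obtain ⟨u', hu', hau'⟩ : ∃ u' < u, a < gaussianCDF u' :=
      (((continuous_gaussianCDF.tendsto u).eventually (lt_mem_nhds ha)).filter_mono
        nhdsWithin_le_nhds |>.and (self_mem_nhdsWithin (s := Set.Iio u))).exists.imp
        fun _ h => ⟨h.2, h.1⟩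
    have hlim := ((tendsto_card_filter_mainPrimes u').sub tendsto_card_filter_exceptional).sub
      ((tendsto_const_nhds (x := (1 : ℝ))).div_atTop tendsto_cutoff)
    rw [sub_zero, sub_zero] at hlim
    filter_upwards [hlim.eventually (lt_mem_nhds hau'), eventually_ge_atTop 1,
      eventually_ge_atTop (3 / (u - u'))] with v hv h1 h2
    refine hv.trans_le ?_
    have hN : (0 : ℝ) < cutoff v := by exact_mod_cast cutoff_pos
    rw [← sub_div, ← sub_div]
    gcongr
    rw [sub_sub, sub_le_iff_le_add]
    norm_cast
    refine (Finset.card_le_card (t := (((Finset.Icc 2 (cutoff v)).filter fun n =>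
      ((sopfr n).primeFactors.card : ℝ) - v ^ 8 ≤ u * v ^ 4)) ∪
      (((Finset.Icc 1 (cutoff v)).filter fun n =>
      (divCount (mainPrimes v) (sopfr n) : ℝ) + 3 * v ^ 2 < (sopfr n).primeFactors.card) ∪ {1}))
      fun n hn => ?_).trans
      ((Finset.card_union_le _ _).trans (by
        have := Finset.card_union_le ((Finset.Icc 1 (cutoff v)).filter fun n =>
          (divCount (mainPrimes v) (sopfr n) : ℝ) + 3 * v ^ 2 < (sopfr n).primeFactors.card) {1}
        rw [Finset.card_singleton] at this
        norm_cast at this ⊢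
        omega))
    rw [Finset.mem_filter, Finset.mem_Icc, div_le_iff₀ (by positivity)] at hn
    simp only [Finset.mem_union, Finset.mem_filter, Finset.mem_Icc, Finset.mem_singleton]
    obtain ⟨⟨hn1, hnN⟩, hle⟩ := hn
    by_cases hn' : n = 1
    · exact Or.inr (Or.inr hn')
    by_cases hbad : (divCount (mainPrimes v) (sopfr n) : ℝ) + 3 * v ^ 2
        < (sopfr n).primeFactors.card
    · exact Or.inr (Or.inl ⟨⟨hn1, hnN⟩, hbad⟩)
    · refine Or.inl ⟨⟨by omega, hnN⟩, ?_⟩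
      rw [div_le_iff₀ (by linarith)] at h2
      have h3 : 3 * v ^ 2 ≤ (u - u') * v ^ 4 := by
        have h4 : v ≤ v ^ 2 := le_self_pow₀ h1 (by norm_num)
        have h5 : 3 ≤ (u - u') * v ^ 2 := by nlinarith
        calc 3 * v ^ 2 ≤ ((u - u') * v ^ 2) * v ^ 2 := by gcongr
          _ = _ := by ring
      nlinarith
  · intro a ha
    filter_upwards [(tendsto_card_filter_mainPrimes u).eventually (gt_mem_nhds ha),
      eventually_ge_atTop 1] with v hv h1
    refine lt_of_le_of_lt ?_ hv
    gcongr
    intro n hn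
    rw [Finset.mem_filter, Finset.mem_Icc] at hn ⊢
    refine ⟨⟨by omega, hn.1.2⟩, ?_⟩
    rw [div_le_iff₀ (by positivity)]
    have h2 : (divCount (mainPrimes v) (sopfr n) : ℝ) ≤ (sopfr n).primeFactors.card := by
      exact_mod_cast divCount_mainPrimes_le (sopfr_ne_zero hn.1.1)
    linarith [hn.2]

/-- Erdős–Kac law for ω(A(n)), where A(n) = Σ_{p^k ∥ n} k·p is the sum of the prime
divisors of n counted with multiplicity. -/
theorem erdosKac_sum_prime_divisors_with_multiplicity (u : ℝ) :
    Tendsto (fun x : ℝ =>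
      (((Finset.Icc 2 ⌊x⌋₊).filter (fun n : ℕ =>
        ((((∑ p ∈ n.primeFactors, n.factorization p * p).primeFactors.card : ℝ) : ℝ)) - Real.log (Real.log x)
          ≤ u * Real.sqrt (Real.log (Real.log x)))).card : ℝ) / x)
      atTop
      (nhds ((Real.sqrt (2 * Real.pi))⁻¹ * ∫ t in Set.Iic u, Real.exp (-t ^ 2 / 2))) := by
  have hloglog := Real.tendsto_log_atTop.comp Real.tendsto_log_atTop
  have hv : Tendsto (fun x : ℝ => (Real.log (Real.log x)) ^ (1 / 8 : ℝ)) atTop atTop :=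
    (tendsto_rpow_atTop (by norm_num)).comp hloglog
  have h := ((tendsto_card_filter_primeFactors u).comp hv).mul
    (tendsto_nat_floor_div_atTop (R := ℝ))
  rw [mul_one] at h
  refine h.congr' ?_
  filter_upwards [hloglog.eventually_ge_atTop 1, Real.tendsto_log_atTop.eventually_ge_atTop 1,
    eventually_ge_atTop 1] with x hx hx1 hx0
  simp only [Function.comp_apply] at hx ⊢
  set l := Real.log (Real.log x)
  have h8 : (l ^ (1 / 8 : ℝ)) ^ 8 = l := by
    rw [← Real.rpow_natCast, ← Real.rpow_mul (by linarith)]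
    norm_num
  have h4 : (l ^ (1 / 8 : ℝ)) ^ 4 = Real.sqrt l := by
    rw [← Real.rpow_natCast, ← Real.rpow_mul (by linarith), Real.sqrt_eq_rpow]
    norm_num
  have hc : cutoff (l ^ (1 / 8 : ℝ)) = ⌊x⌋₊ := by
    rw [cutoff, h8, Real.exp_log (by linarith), Real.exp_log (by linarith)]
  rw [h8, h4, hc]
  have hfl : ((⌊x⌋₊ : ℕ) : ℝ) ≠ 0 := by
    have := Nat.floor_pos.2 hx0
    exact_mod_cast this.ne'
  rw [div_mul_div_cancel₀ hfl]
  rfl
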